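/- Let w be a permutation with w(i) > w(i−1) for all i ≤ 0, and let c₁,…,c_m, d₁,…,d_m be integers with c_i > 0 ≥ d_i for each i, d₁ > d₂ > … > d_m, and ℓ(w·s_{c₁,d₁}⋯s_{c_{m′},d_{m′}}) = ℓ(w) + m′ for every m′ ≤ m. Then for every rc-graph R′ with w_{R′} = w·s_{c₁,d₁}⋯s_{c_m,d_m} there exist an rc-graph R with w_R = w and a weakly increasing sequence 1 ≤ a₁ ≤ a₂ ≤ … ≤ a_m ≤ n such that R ← a₁a₂⋯a_m = R′. -/

import Mathlib

open scoped Classical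

noncomputable section

namespace RCGraphs

/-- The simple transposition `s j`, interchanging `j` and `j+1`. -/
def sT (j : ℤ) : Equiv.Perm ℤ := Equiv.swap j (j + 1)

/-- The Coxeter length of a permutation of `ℤ`: the minimal length of an expression
as a product of simple transpositions. -/
def len (w : Equiv.Perm ℤ) : ℕ :=
  sInf {m : ℕ | ∃ l : List ℤ, l.length = m ∧ (l.map sT).prod = w}

/-- The permutations considered in the paper: bijections of `ℤ` fixing every `i > n`
and fixing all sufficiently small integers. -/
def IsPermZ (n : ℤ) (w : Equiv.Perm ℤ) : Prop :=
  (∀ i : ℤ, n < i → w i = i) ∧ ∃ N : ℤ, ∀ i : ℤ, i < N → w i = i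

/-- The reading order on positions `(i,k)`: rows (second coordinate) from `n` downward,
and within a row in order of increasing first coordinate. -/
def rcOrder (p q : ℤ × ℤ) : Prop :=
  q.2 < p.2 ∨ (p.2 = q.2 ∧ p.1 ≤ q.1)

instance : DecidableRel rcOrder := fun p q => by
  unfold rcOrder; infer_instance

instance : IsTrans (ℤ × ℤ) rcOrder :=
  ⟨fun a b c h₁ h₂ => by unfold rcOrder at *; omega⟩

instance : IsAntisymm (ℤ × ℤ) rcOrder :=
  ⟨fun a b h₁ h₂ => by
    unfold rcOrder at *
    have h3 : a.1 = b.1 ∧ a.2 = b.2 := by omega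
    exact Prod.ext h3.1 h3.2⟩

instance : IsTotal (ℤ × ℤ) rcOrder :=
  ⟨fun a b => by unfold rcOrder; omega⟩

/-- The permutation `w_R` associated to a finite set of positions `R`: the product of the
simple transpositions `s_{i+k-n-1}`, `(i,k) ∈ R`, in the reading order. -/
def wR (n : ℤ) (R : Finset (ℤ × ℤ)) : Equiv.Perm ℤ :=
  ((R.sort rcOrder).map fun p => sT (p.1 + p.2 - n - 1)).prod

/-- `R` is an rc-graph: positions lie in the grid `{(i,k) : i ≤ n, k ≤ n}` and the
reading word is reduced. -/
def IsRC (n : ℤ) (R : Finset (ℤ × ℤ)) : Prop :=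
  (∀ p ∈ R, p.1 ≤ n ∧ p.2 ≤ n) ∧ len (wR n R) = R.card

/-- Condition (*): `w_R(i) > w_R(i-1)` for all `i ≤ 0`; equivalently no two strands with
nonpositive labels cross. -/
def Star (n : ℤ) (R : Finset (ℤ × ℤ)) : Prop :=
  ∀ i : ℤ, i ≤ 0 → wR n R (i - 1) < wR n R i

/-- Strand labels in the wiring diagram of `R` (for diagrams all of whose crossings lie in
rows `k ≥ 1`, as is the case under condition (*)).  `lab n R true i k` is the label of the
strand entering position `(i,k)` from the west (the strand passing above, if `(i,k)` is not
a crossing); `lab n R false i k` is the label of the strand entering from the south (the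
strand passing below).  Each strand is labeled by the row where it begins. -/
def lab (n : ℤ) (R : Finset (ℤ × ℤ)) : Bool → ℤ → ℤ → ℤ
  | true, i, k =>
      if h : n ≤ i then k
      else if (i + 1, k) ∈ R then lab n R true (i + 1) k else lab n R false (i + 1) k
  | false, i, k =>
      if h : k ≤ 0 then i + k - n - 1
      else if (i, k - 1) ∈ R then lab n R false i (k - 1) else lab n R true i (k - 1)
  termination_by b i k => ((n - i).toNat + k.toNat)
  decreasing_by
    all_goals simp_wf
    all_goals omega

/-- The label of the strand leaving position `(i,r)` northward. -/
def northLabel (n : ℤ) (R : Finset (ℤ × ℤ)) (i r : ℤ) : ℤ :=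
  if (i, r) ∈ R then lab n R false i r else lab n R true i r

/-- `(i,k)` is an open space: not a crossing, the strand passing below it has a
nonpositive label and the strand passing above it has a positive label. -/
def OpenSpace (n : ℤ) (R : Finset (ℤ × ℤ)) (i k : ℤ) : Prop :=
  i ≤ n ∧ (i, k) ∉ R ∧ lab n R false i k ≤ 0 ∧ 0 < lab n R true i k

/-- The main loop of the Bergeron--Billey insertion algorithm, recording the trace:
the list of pairs (current diagram, crossing just added).  `R` always contains the
crossing `p` that was just added. -/
def insertSteps (n : ℤ) : ℕ → Finset (ℤ × ℤ) → ℤ × ℤ → List (Finset (ℤ × ℤ) × (ℤ × ℤ))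
  | 0, _, _ => []
  | fuel + 1, R, p =>
      (R, p) ::
        if IsRC n R then []
        else
          let a := lab n R true p.1 p.2
          let b := lab n R false p.1 p.2
          -- the unique other crossing of the two strands that cross at `p`
          let C := R.filter fun q =>
            q ≠ p ∧ ((lab n R true q.1 q.2 = a ∧ lab n R false q.1 q.2 = b) ∨
                     (lab n R true q.1 q.2 = b ∧ lab n R false q.1 q.2 = a))
          let q := (C.sort rcOrder).headI
          let R' := R.erase q
          let i' := sInf {x : ℤ | q.1 < x ∧ OpenSpace n R' x q.2}
          insertSteps n fuel (insert (i', q.2) R') (i', q.2)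

/-- The trace of the insertion of `k` into `R`: the states of the algorithm together with
the crossings added at each step. -/
def insertStepsOf (n : ℤ) (R : Finset (ℤ × ℤ)) (k : ℤ) : List (Finset (ℤ × ℤ) × (ℤ × ℤ)) :=
  let i₁ := sInf {x : ℤ | OpenSpace n R x k}
  insertSteps n ((n + 1 - k).toNat + 1) (insert (i₁, k) R) (i₁, k)

/-- The insertion `R ← k` of Bergeron and Billey. -/
def insertOne (n : ℤ) (R : Finset (ℤ × ℤ)) (k : ℤ) : Finset (ℤ × ℤ) :=
  ((insertStepsOf n R k).getLast?.getD (R, (0, 0))).1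

/-- The insertion `R ← v` of a word. -/
def insertWord (n : ℤ) (R : Finset (ℤ × ℤ)) (v : List ℕ) : Finset (ℤ × ℤ) :=
  v.foldl (fun S a => insertOne n S (a : ℤ)) R

/-- The column (first coordinate) at which the strand labeled `a` of the diagram `R`
leaves row `r` northward. -/
def strandCol (n : ℤ) (R : Finset (ℤ × ℤ)) (a r : ℤ) : ℤ :=
  sSup {i : ℤ | i ≤ n ∧ northLabel n R i r = a}

/-- Given the trace `L` of an insertion, the column occupied in row `r` by the left path
(`left = true`) or the right path (`left = false`) of the insertion.  Between the rows of
the `t`-th and `(t+1)`-st added crossings, the left path is the piece `s_t` of the strand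
whose label changes from `a_t` to `b_t`, and the right path is the piece `s^t` whose label
changes from `b_t` to `a_t`. -/
def pathCol (n : ℤ) (L : List (Finset (ℤ × ℤ) × (ℤ × ℤ))) (left : Bool) (r : ℤ) : ℤ :=
  match (L.filter fun e => e.2.2 ≤ r).getLast? with
  | some e => strandCol n e.1 (lab n e.1 left e.2.1 e.2.2) r
  | none => 0

/-- A semistandard Young tableau with at most `n` rows (rows indexed `1,…,n`, row `j`
having `μ j` boxes, columns indexed from `0`), with entries in `{1,…,n}`, weakly
increasing along rows and strictly increasing down columns; entries outside the shape
are `0`. -/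
structure SSYT (n : ℕ) (μ : ℕ → ℕ) where
  entry : ℕ → ℕ → ℕ
  entry_mem : ∀ j c, 1 ≤ j → j ≤ n → c < μ j → 1 ≤ entry j c ∧ entry j c ≤ n
  row_weak : ∀ j c₁ c₂, 1 ≤ j → j ≤ n → c₁ ≤ c₂ → c₂ < μ j → entry j c₁ ≤ entry j c₂
  col_strict : ∀ j₁ j₂ c, 1 ≤ j₁ → j₁ < j₂ → j₂ ≤ n → c < μ j₂ → entry j₁ c < entry j₂ c
  outside : ∀ j c, j = 0 ∨ n < j ∨ μ j ≤ c → entry j c = 0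

/-- `μ` is a partition with (at most) `n` parts `μ 1 ≥ μ 2 ≥ … ≥ μ n ≥ 0`
(and `μ j = 0` outside `1,…,n`). -/
def IsPartition (n : ℕ) (μ : ℕ → ℕ) : Prop :=
  (∀ j, 1 ≤ j → j < n → μ (j + 1) ≤ μ j) ∧ ∀ j, j = 0 ∨ n < j → μ j = 0

/-- The reading word of a tableau: the rows read left to right, from the bottom row
to the top one. -/
def readingWord (n : ℕ) (μ : ℕ → ℕ) (Y : SSYT n μ) : List ℕ :=
  ((List.range n).reverse.map (· + 1)).flatMap fun j =>
    (List.range (μ j)).map fun c => Y.entry j c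

/-- An elementary Knuth move. -/
def KnuthMove (w₁ w₂ : List ℕ) : Prop :=
  (∃ (u v : List ℕ) (x y z : ℕ), x < y ∧ y ≤ z ∧
      w₁ = u ++ y :: x :: z :: v ∧ w₂ = u ++ y :: z :: x :: v) ∨
  (∃ (u v : List ℕ) (x y z : ℕ), x ≤ y ∧ y < z ∧
      w₁ = u ++ x :: z :: y :: v ∧ w₂ = u ++ z :: x :: y :: v)

/-- Knuth equivalence: the equivalence relation generated by elementary Knuth moves. -/
def KnuthEquiv (w₁ w₂ : List ℕ) : Prop := Relation.EqvGen KnuthMove w₁ w₂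

/-- The monomial `x^R = ∏_{(i,k) ∈ R} x_k`. -/
def xR (R : Finset (ℤ × ℤ)) : MvPolynomial ℕ ℤ :=
  ∏ p ∈ R, MvPolynomial.X p.2.toNat

/-- The monomial `x^Y = ∏ x_i`, one factor for each entry `i` of `Y`. -/
def xY (n : ℕ) (μ : ℕ → ℕ) (Y : SSYT n μ) : MvPolynomial ℕ ℤ :=
  ((readingWord n μ Y).map MvPolynomial.X).prod

/-- The Schubert polynomial `S_w = Σ_{R : w_R = w} x^R`. -/
def Schub (n : ℤ) (w : Equiv.Perm ℤ) : MvPolynomial ℕ ℤ :=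
  ∑ᶠ R ∈ {R : Finset (ℤ × ℤ) | IsRC n R ∧ wR n R = w}, xR R

/-- The Schur polynomial `s_μ(x₁,…,x_n) = Σ_Y x^Y`, summing over all semistandard Young
tableaux of shape `μ` with entries in `{1,…,n}`. -/
def SchurP (n : ℕ) (μ : ℕ → ℕ) : MvPolynomial ℕ ℤ :=
  ∑ᶠ Y : SSYT n μ, xY n μ Y

/-- The complete homogeneous symmetric polynomial
`h_m = Σ_{1 ≤ i₁ ≤ … ≤ i_m ≤ n} x_{i₁} ⋯ x_{i_m}`. -/
def hPoly (n m : ℕ) : MvPolynomial ℕ ℤ :=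
  ∑ s ∈ (Finset.Icc 1 n).sym m, (s.1.map MvPolynomial.X).prod

/-- The top rc-graph `R(μ) = {(i,k) : 1 ≤ k ≤ n, n - μ_k + 1 ≤ i ≤ n}` of a partition. -/
def Rmu (n : ℕ) (μ : ℕ → ℕ) : Finset (ℤ × ℤ) :=
  (Finset.Icc 1 (n : ℤ)).biUnion fun k =>
    (Finset.Icc ((n : ℤ) - μ k.toNat + 1) (n : ℤ)).image fun i => (i, k)


/-! ## Basic machinery: products over later-closed pieces -/

/-- index of the simple transposition at a position -/
def jx (n : ℤ) (p : ℤ × ℤ) : ℤ := p.1 + p.2 - n - 1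

/-- `p` is read strictly before `q` -/
def rlt (p q : ℤ × ℤ) : Prop := q.2 < p.2 ∨ (p.2 = q.2 ∧ p.1 < q.1)

/-- the crossings of `D` read strictly after `p` -/
def aft (D : Finset (ℤ × ℤ)) (p : ℤ × ℤ) : Finset (ℤ × ℤ) := D.filter fun q => rlt p q

/-- label of the strand entering `p` from the south -/
def lo (n : ℤ) (D : Finset (ℤ × ℤ)) (p : ℤ × ℤ) : ℤ := (wR n (aft D p))⁻¹ (jx n p)

/-- label of the strand entering `p` from the west -/
def hi (n : ℤ) (D : Finset (ℤ × ℤ)) (p : ℤ × ℤ) : ℤ := (wR n (aft D p))⁻¹ (jx n p + 1)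

/-- the crossings in rows at most `l` -/
def rows (D : Finset (ℤ × ℤ)) (l : ℤ) : Finset (ℤ × ℤ) := D.filter fun q => q.2 ≤ l

/-- the permutation of the rows at most `l` -/
def V (n : ℤ) (D : Finset (ℤ × ℤ)) (l : ℤ) : Equiv.Perm ℤ := wR n (rows D l)

/-- local form of reducedness -/
def Red (n : ℤ) (D : Finset (ℤ × ℤ)) : Prop := ∀ p ∈ D, lo n D p < hi n D p

theorem perm_inv_self (w : Equiv.Perm ℤ) (x : ℤ) : w⁻¹ (w x) = x := by simp

theorem rlt_irrefl (p : ℤ × ℤ) : ¬ rlt p p := by unfold rlt; omega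

theorem rlt_trans {p q r : ℤ × ℤ} (h : rlt p q) (h' : rlt q r) : rlt p r := by
  unfold rlt at *; omega

theorem rlt_asymm {p q : ℤ × ℤ} (h : rlt p q) : ¬ rlt q p := by
  unfold rlt at *; omega

theorem rlt_tri (p q : ℤ × ℤ) : rlt p q ∨ p = q ∨ rlt q p := by
  unfold rlt
  by_cases h : p = q
  · right; left; exact h
  · have : ¬ (p.1 = q.1 ∧ p.2 = q.2) := fun h' => h (Prod.ext h'.1 h'.2)
    omega

theorem mem_aft {D : Finset (ℤ × ℤ)} {p q : ℤ × ℤ} : q ∈ aft D p ↔ q ∈ D ∧ rlt p q := by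
  simp [aft]

theorem mem_rows {D : Finset (ℤ × ℤ)} {l : ℤ} {q : ℤ × ℤ} : q ∈ rows D l ↔ q ∈ D ∧ q.2 ≤ l := by
  simp [rows]

theorem wR_empty (n : ℤ) : wR n ∅ = 1 := by simp [wR]

theorem wR_insert_first (n : ℤ) (p : ℤ × ℤ) (S : Finset (ℤ × ℤ)) (h : ∀ x ∈ S, rlt p x) :
    wR n (insert p S) = sT (jx n p) * wR n S := by
  unfold wR
  rw [Finset.sort_insert]
  · simp [jx]
  · intro b hb
    have := h b hb
    unfold rlt at this; unfold rcOrder; omega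
  · intro hp; exact rlt_irrefl p (h p hp)

theorem rc_induction {P : Finset (ℤ × ℤ) → Prop} (h0 : P ∅)
    (hs : ∀ p S, (∀ x ∈ S, rlt p x) → P S → P (insert p S)) : ∀ S, P S := by
  intro S
  refine Finset.induction_on_min_value (fun p : ℤ × ℤ => toLex (-p.2, p.1)) S h0 ?_
  intro a s ha hle hP
  refine hs a s ?_ hP
  intro x hx
  have h1 := hle x hx
  have h2 : a ≠ x := fun h => ha (h ▸ hx)
  have h3 : ¬ (a.1 = x.1 ∧ a.2 = x.2) := fun h' => h2 (Prod.ext h'.1 h'.2)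
  rw [Prod.Lex.le_iff] at h1
  simp only [ofLex_toLex] at h1
  unfold rlt
  omega

theorem wR_union (n : ℤ) (A B : Finset (ℤ × ℤ)) (h : ∀ x ∈ A, ∀ y ∈ B, rlt x y) :
    wR n (A ∪ B) = wR n A * wR n B := by
  revert h
  refine rc_induction (P := fun A => (∀ x ∈ A, ∀ y ∈ B, rlt x y) →
    wR n (A ∪ B) = wR n A * wR n B) ?_ ?_ A
  · intro _; simp [wR_empty]
  · intro p S hp ih h
    rw [Finset.insert_union, wR_insert_first, wR_insert_first n p S hp, ih, mul_assoc]
    · intro x hx y hy; exact h x (Finset.mem_insert_of_mem hx) y hy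
    · intro x hx
      rcases Finset.mem_union.1 hx with hx | hx
      · exact hp x hx
      · exact h p (Finset.mem_insert_self _ _) x hx

theorem wR_fix (n : ℤ) (S : Finset (ℤ × ℤ)) (x : ℤ)
    (h : ∀ p ∈ S, jx n p ≠ x ∧ jx n p + 1 ≠ x) : wR n S x = x := by
  revert h
  refine rc_induction (P := fun S => (∀ p ∈ S, jx n p ≠ x ∧ jx n p + 1 ≠ x) → wR n S x = x)
    ?_ ?_ S
  · intro _; simp [wR_empty]
  · intro p S hp ih h
    rw [wR_insert_first n p S hp, Equiv.Perm.mul_apply, ih (fun q hq => h q (Finset.mem_insert_of_mem hq))]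
    have := h p (Finset.mem_insert_self _ _)
    unfold sT
    exact Equiv.swap_apply_of_ne_of_ne (Ne.symm this.1) (Ne.symm this.2)

theorem wR_fix_inv (n : ℤ) (S : Finset (ℤ × ℤ)) (x : ℤ)
    (h : ∀ p ∈ S, jx n p ≠ x ∧ jx n p + 1 ≠ x) : (wR n S)⁻¹ x = x := by
  rw [Equiv.Perm.inv_eq_iff_eq]; exact (wR_fix n S x h).symm

/-- `X` is closed under reading later inside `D` -/
def Low (X D : Finset (ℤ × ℤ)) : Prop := X ⊆ D ∧ ∀ x ∈ X, ∀ y ∈ D, rlt x y → y ∈ X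

theorem Low.aft_eq {X D : Finset (ℤ × ℤ)} (h : Low X D) {p : ℤ × ℤ} (hp : p ∈ X) :
    aft X p = aft D p := by
  ext q; simp only [mem_aft]
  exact ⟨fun hq => ⟨h.1 hq.1, hq.2⟩, fun hq => ⟨h.2 p hp q hq.1 hq.2, hq.2⟩⟩

theorem Low.red {n : ℤ} {X D : Finset (ℤ × ℤ)} (h : Low X D) (hD : Red n D) : Red n X := by
  intro p hp
  have := hD p (h.1 hp)
  unfold lo hi at *
  rwa [h.aft_eq hp]

theorem low_rows (D : Finset (ℤ × ℤ)) (l : ℤ) : Low (rows D l) D := by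
  refine ⟨fun x hx => (mem_rows.1 hx).1, fun x hx y hy hxy => mem_rows.2 ⟨hy, ?_⟩⟩
  have := (mem_rows.1 hx).2
  unfold rlt at hxy; omega

theorem low_rows_rows (D : Finset (ℤ × ℤ)) {l l' : ℤ} (hl : l ≤ l') : Low (rows D l) (rows D l') := by
  refine ⟨fun x hx => ?_, fun x hx y hy hxy => ?_⟩
  · rw [mem_rows] at *; exact ⟨hx.1, hx.2.trans hl⟩
  · rw [mem_rows] at *
    unfold rlt at hxy; exact ⟨hy.1, by omega⟩

theorem low_aft (D : Finset (ℤ × ℤ)) (p : ℤ × ℤ) : Low (aft D p) D := by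
  refine ⟨fun x hx => (mem_aft.1 hx).1, fun x hx y hy hxy => mem_aft.2 ⟨hy, ?_⟩⟩
  exact rlt_trans (mem_aft.1 hx).2 hxy

theorem low_insert {p : ℤ × ℤ} {S : Finset (ℤ × ℤ)} (hp : ∀ x ∈ S, rlt p x) : Low S (insert p S) := by
  refine ⟨Finset.subset_insert _ _, fun x hx y hy hxy => ?_⟩
  rcases Finset.mem_insert.1 hy with rfl | hy
  · exact absurd (hp x hx) (rlt_asymm hxy)
  · exact hy

theorem aft_insert_first {p : ℤ × ℤ} {S : Finset (ℤ × ℤ)} (hp : ∀ x ∈ S, rlt p x) :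
    aft (insert p S) p = S := by
  ext q; simp only [mem_aft, Finset.mem_insert]
  constructor
  · rintro ⟨rfl | h, h'⟩
    · exact absurd h' (rlt_irrefl _)
    · exact h
  · intro h; exact ⟨Or.inr h, hp q h⟩

/-- the effect of one letter on the order of two values -/
theorem sT_step {j x y : ℤ} (hxy : x < y) (h : ¬ (x = j ∧ y = j + 1)) : sT j x < sT j y := by
  unfold sT
  simp only [Equiv.swap_apply_def]
  split_ifs <;> omega

theorem inv_mono {n : ℤ} {D : Finset (ℤ × ℤ)} (hD : Red n D) :
    ∀ X, Low X D → ∀ a b : ℤ, b < a → wR n X a < wR n X b → wR n D a < wR n D b := by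
  revert hD
  refine rc_induction (P := fun D => Red n D → ∀ X, Low X D → ∀ a b : ℤ, b < a →
    wR n X a < wR n X b → wR n D a < wR n D b) ?_ ?_ D
  · intro _ X hX a b _ h
    rwa [Finset.subset_empty.1 hX.1] at h
  · intro p S hp ih hR X hX a b hab h
    by_cases hpX : p ∈ X
    · have : X = insert p S := by
        apply Finset.Subset.antisymm hX.1
        intro y hy
        rcases Finset.mem_insert.1 hy with rfl | hy'
        · exact hpX
        · exact hX.2 p hpX y hy (hp y hy')
      rwa [this] at h
    · have hXS : Low X S := by
        refine ⟨fun x hx => ?_, fun x hx y hy => hX.2 x hx y (Finset.mem_insert_of_mem hy)⟩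
        rcases Finset.mem_insert.1 (hX.1 hx) with rfl | hx'
        · exact absurd hx hpX
        · exact hx'
      have h1 := ih ((low_insert hp).red hR) X hXS a b hab h
      rw [wR_insert_first n p S hp, Equiv.Perm.mul_apply, Equiv.Perm.mul_apply]
      apply sT_step h1
      rintro ⟨ha, hb⟩
      have h2 := hR p (Finset.mem_insert_self _ _)
      unfold lo hi at h2
      rw [aft_insert_first hp, ← ha, perm_inv_self, ha, ← hb,
        perm_inv_self] at h2
      omega

theorem exists_cross {n : ℤ} (D : Finset (ℤ × ℤ)) (a b : ℤ) (hab : b < a)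
    (h : wR n D a < wR n D b) : ∃ p ∈ D, lo n D p = b ∧ hi n D p = a := by
  revert h
  refine rc_induction (P := fun D => wR n D a < wR n D b →
    ∃ p ∈ D, lo n D p = b ∧ hi n D p = a) ?_ ?_ D
  · intro h; simp [wR_empty] at h; omega
  · intro p S hp ih h
    by_cases hS : wR n S a < wR n S b
    · obtain ⟨q, hq, h1, h2⟩ := ih hS
      refine ⟨q, Finset.mem_insert_of_mem hq, ?_⟩
      unfold lo hi at *
      rw [← (low_insert hp).aft_eq hq]
      exact ⟨h1, h2⟩
    · have hne : wR n S a ≠ wR n S b := fun h' => by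
        have := (wR n S).injective h'; omega
      have hlt : wR n S b < wR n S a := by omega
      refine ⟨p, Finset.mem_insert_self _ _, ?_⟩
      rw [wR_insert_first n p S hp, Equiv.Perm.mul_apply, Equiv.Perm.mul_apply] at h
      have h3 : wR n S b = jx n p ∧ wR n S a = jx n p + 1 := by
        by_contra hc
        have := sT_step hlt hc
        omega
      unfold lo hi
      rw [aft_insert_first hp, ← h3.1, perm_inv_self, h3.1, ← h3.2,
        perm_inv_self]
      exact ⟨rfl, rfl⟩

theorem wR_aft_lo (n : ℤ) (D : Finset (ℤ × ℤ)) (p : ℤ × ℤ) : wR n (aft D p) (lo n D p) = jx n p := by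
  simp [lo]

theorem wR_aft_hi (n : ℤ) (D : Finset (ℤ × ℤ)) (p : ℤ × ℤ) :
    wR n (aft D p) (hi n D p) = jx n p + 1 := by
  simp [hi]

theorem cross_not_rlt {n : ℤ} {D : Finset (ℤ × ℤ)} (hD : Red n D) {p q : ℤ × ℤ} (hq : q ∈ D)
    (h1 : lo n D p = lo n D q) (h2 : hi n D p = hi n D q) : ¬ rlt p q := by
  intro hpq
  have hX : Low (insert q (aft D q)) (aft D p) := by
    refine ⟨fun x hx => ?_, fun x hx y hy hxy => ?_⟩
    · rcases Finset.mem_insert.1 hx with rfl | hx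
      · exact mem_aft.2 ⟨hq, hpq⟩
      · rw [mem_aft] at *; exact ⟨hx.1, rlt_trans hpq hx.2⟩
    · rw [mem_aft] at hy
      refine Finset.mem_insert_of_mem (mem_aft.2 ⟨hy.1, ?_⟩)
      rcases Finset.mem_insert.1 hx with rfl | hx
      · exact hxy
      · exact rlt_trans (mem_aft.1 hx).2 hxy
  have := inv_mono ((low_aft D p).red hD) _ hX (hi n D q) (lo n D q) (hD q hq) (by
    rw [wR_insert_first n q _ (fun x hx => (mem_aft.1 hx).2), Equiv.Perm.mul_apply,
      Equiv.Perm.mul_apply, wR_aft_lo, wR_aft_hi]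
    simp [sT])
  rw [← h1, ← h2, wR_aft_lo, wR_aft_hi] at this
  omega

theorem cross_unique {n : ℤ} {D : Finset (ℤ × ℤ)} (hD : Red n D) {p q : ℤ × ℤ} (hp : p ∈ D)
    (hq : q ∈ D) (h1 : lo n D p = lo n D q) (h2 : hi n D p = hi n D q) : p = q := by
  rcases rlt_tri p q with h | h | h
  · exact absurd h (cross_not_rlt hD hq h1 h2)
  · exact h
  · exact absurd h (cross_not_rlt hD hp h1.symm h2.symm)

/-! ## Adding a crossing -/

theorem wR_insert (n : ℤ) (D : Finset (ℤ × ℤ)) (p : ℤ × ℤ) (hp : p ∉ D) :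
    wR n (insert p D) = wR n D * Equiv.swap (lo n D p) (hi n D p) := by
  have hD : D = (D.filter fun q => rlt q p) ∪ aft D p := by
    ext q
    simp only [Finset.mem_union, Finset.mem_filter, mem_aft]
    constructor
    · intro hq
      rcases rlt_tri p q with h | h | h
      · exact Or.inr ⟨hq, h⟩
      · exact absurd (h ▸ hq) hp
      · exact Or.inl ⟨hq, h⟩
    · rintro (h | h) <;> exact h.1
  have hpD : insert p D = (D.filter fun q => rlt q p) ∪ insert p (aft D p) := by
    rw [Finset.union_insert, ← hD]
  have e1 : wR n D = wR n (D.filter fun q => rlt q p) * wR n (aft D p) := by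
    conv_lhs => rw [hD]
    apply wR_union
    intro x hx y hy
    exact rlt_trans (Finset.mem_filter.1 hx).2 (mem_aft.1 hy).2
  rw [hpD, wR_union, wR_insert_first, e1, mul_assoc]
  · congr 1
    unfold lo hi sT
    rw [Equiv.swap_apply_apply]
    simp [mul_assoc]
  · intro x hx; exact (mem_aft.1 hx).2
  · intro x hx y hy
    have h1 := (Finset.mem_filter.1 hx).2
    rcases Finset.mem_insert.1 hy with rfl | hy
    · exact h1
    · exact rlt_trans h1 (mem_aft.1 hy).2

theorem aft_insert_of_not {D : Finset (ℤ × ℤ)} {p x : ℤ × ℤ} (h : ¬ rlt x p) :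
    aft (insert p D) x = aft D x := by
  ext q; simp only [mem_aft, Finset.mem_insert]
  constructor
  · rintro ⟨rfl | h1, h2⟩
    · exact absurd h2 h
    · exact ⟨h1, h2⟩
  · rintro ⟨h1, h2⟩; exact ⟨Or.inr h1, h2⟩

theorem aft_insert_of_rlt {D : Finset (ℤ × ℤ)} {p x : ℤ × ℤ} (h : rlt x p) :
    aft (insert p D) x = insert p (aft D x) := by
  ext q; simp only [mem_aft, Finset.mem_insert]
  constructor
  · rintro ⟨rfl | h1, h2⟩
    · exact Or.inl rfl
    · exact Or.inr ⟨h1, h2⟩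
  · rintro (rfl | ⟨h1, h2⟩)
    · exact ⟨Or.inl rfl, h⟩
    · exact ⟨Or.inr h1, h2⟩

theorem aft_aft {D : Finset (ℤ × ℤ)} {p x : ℤ × ℤ} (h : rlt x p) : aft (aft D x) p = aft D p := by
  ext q; simp only [mem_aft]
  exact ⟨fun h' => ⟨h'.1.1, h'.2⟩, fun h' => ⟨⟨h'.1, rlt_trans h h'.2⟩, h'.2⟩⟩

theorem aft_rows {D : Finset (ℤ × ℤ)} {p : ℤ × ℤ} {l : ℤ} (h : p.2 ≤ l) :
    aft (rows D l) p = aft D p := by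
  ext q; simp only [mem_aft, mem_rows]
  refine ⟨fun h' => ⟨h'.1.1, h'.2⟩, fun h' => ⟨⟨h'.1, ?_⟩, h'.2⟩⟩
  have := h'.2
  unfold rlt at this; omega

theorem wR_aft_insert_of_rlt {n : ℤ} {D : Finset (ℤ × ℤ)} {p x : ℤ × ℤ} (hp : p ∉ D) (h : rlt x p) :
    wR n (aft (insert p D) x) = wR n (aft D x) * Equiv.swap (lo n D p) (hi n D p) := by
  rw [aft_insert_of_rlt h, wR_insert]
  · unfold lo hi; rw [aft_aft h]
  · intro h'; exact hp (mem_aft.1 h').1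

theorem lo_insert_of_rlt {n : ℤ} {D : Finset (ℤ × ℤ)} {p x : ℤ × ℤ} (hp : p ∉ D) (h : rlt x p) :
    lo n (insert p D) x = Equiv.swap (lo n D p) (hi n D p) (lo n D x) := by
  conv_lhs => unfold lo
  rw [wR_aft_insert_of_rlt hp h, mul_inv_rev, Equiv.Perm.mul_apply, Equiv.swap_inv]; rfl

theorem hi_insert_of_rlt {n : ℤ} {D : Finset (ℤ × ℤ)} {p x : ℤ × ℤ} (hp : p ∉ D) (h : rlt x p) :
    hi n (insert p D) x = Equiv.swap (lo n D p) (hi n D p) (hi n D x) := by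
  conv_lhs => unfold hi
  rw [wR_aft_insert_of_rlt hp h, mul_inv_rev, Equiv.Perm.mul_apply, Equiv.swap_inv]; rfl

theorem lo_insert_of_not {n : ℤ} {D : Finset (ℤ × ℤ)} {p x : ℤ × ℤ} (h : ¬ rlt x p) :
    lo n (insert p D) x = lo n D x := by
  unfold lo; rw [aft_insert_of_not h]

theorem hi_insert_of_not {n : ℤ} {D : Finset (ℤ × ℤ)} {p x : ℤ × ℤ} (h : ¬ rlt x p) :
    hi n (insert p D) x = hi n D x := by
  unfold hi; rw [aft_insert_of_not h]

theorem rows_insert_of_le {D : Finset (ℤ × ℤ)} {p : ℤ × ℤ} {l : ℤ} (h : p.2 ≤ l) :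
    rows (insert p D) l = insert p (rows D l) := by
  unfold rows; rw [Finset.filter_insert, if_pos h]

theorem rows_insert_of_lt {D : Finset (ℤ × ℤ)} {p : ℤ × ℤ} {l : ℤ} (h : l < p.2) :
    rows (insert p D) l = rows D l := by
  unfold rows; rw [Finset.filter_insert, if_neg (by omega)]

theorem V_insert_of_le {n : ℤ} {D : Finset (ℤ × ℤ)} {p : ℤ × ℤ} {l : ℤ} (hp : p ∉ D) (h : p.2 ≤ l) :
    V n (insert p D) l = V n D l * Equiv.swap (lo n D p) (hi n D p) := by
  unfold V
  rw [rows_insert_of_le h, wR_insert]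
  · unfold lo hi; rw [aft_rows h]
  · intro h'; exact hp (mem_rows.1 h').1

theorem V_insert_of_lt {n : ℤ} {D : Finset (ℤ × ℤ)} {p : ℤ × ℤ} {l : ℤ} (h : l < p.2) :
    V n (insert p D) l = V n D l := by
  unfold V; rw [rows_insert_of_lt h]

/-! ## Length and inversions -/

/-- the inversion set -/
def Invs (w : Equiv.Perm ℤ) : Set (ℤ × ℤ) := {x | x.1 < x.2 ∧ w x.2 < w x.1}

theorem Invs_one : Invs 1 = ∅ := by
  ext x; simp [Invs]; omega

theorem Invs_mul_subset (w : Equiv.Perm ℤ) (j : ℤ) :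
    Invs (sT j * w) ⊆ insert (w⁻¹ j, w⁻¹ (j + 1)) (Invs w) := by
  rintro ⟨a, b⟩ ⟨h1, h2⟩
  simp only [Equiv.Perm.mul_apply] at h1 h2
  by_cases h : w b < w a
  · exact Or.inr ⟨h1, h⟩
  · have hne : w a ≠ w b := fun h' => by
      have := w.injective h'; omega
    have h3 : w a = j ∧ w b = j + 1 := by
      by_contra hc
      have := sT_step (lt_of_le_of_ne (not_lt.1 h) hne) hc
      omega
    left
    rw [← h3.2, ← h3.1]; simp

theorem Invs_word (l : List ℤ) :
    (Invs (l.map sT).prod).Finite ∧ (Invs (l.map sT).prod).ncard ≤ l.length := by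
  induction l with
  | nil => simp [Invs_one]
  | cons j l ih =>
    simp only [List.map_cons, List.prod_cons, List.length_cons]
    have hs := Invs_mul_subset (l.map sT).prod j
    have hf := ih.1.insert (((l.map sT).prod)⁻¹ j, ((l.map sT).prod)⁻¹ (j + 1))
    refine ⟨hf.subset hs, ?_⟩
    have h1 := Set.ncard_le_ncard hs hf
    have h2 := Set.ncard_insert_le (((l.map sT).prod)⁻¹ j, ((l.map sT).prod)⁻¹ (j + 1))
      (Invs (l.map sT).prod)
    omega

theorem wR_word (n : ℤ) (D : Finset (ℤ × ℤ)) :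
    ∃ l : List ℤ, l.length = D.card ∧ (l.map sT).prod = wR n D := by
  refine ⟨(D.sort rcOrder).map (jx n), by simp, ?_⟩
  rw [List.map_map]; rfl

theorem Invs_wR_finite (n : ℤ) (D : Finset (ℤ × ℤ)) : (Invs (wR n D)).Finite := by
  obtain ⟨l, _, h⟩ := wR_word n D
  rw [← h]; exact (Invs_word l).1

theorem Invs_red {n : ℤ} {D : Finset (ℤ × ℤ)} (hD : Red n D) : (Invs (wR n D)).ncard = D.card := by
  revert hD
  refine rc_induction (P := fun D => Red n D → (Invs (wR n D)).ncard = D.card) ?_ ?_ D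
  · intro _; simp [wR_empty, Invs_one]
  · intro p S hp ih hR
    have hpS : p ∉ S := fun h => rlt_irrefl p (hp p h)
    have h1 := ih ((low_insert hp).red hR)
    have h2 := hR p (Finset.mem_insert_self _ _)
    unfold lo hi at h2
    rw [aft_insert_first hp] at h2
    have h3 : Invs (wR n (insert p S)) =
        insert ((wR n S)⁻¹ (jx n p), (wR n S)⁻¹ (jx n p + 1)) (Invs (wR n S)) := by
      rw [wR_insert_first n p S hp]
      apply Set.Subset.antisymm (Invs_mul_subset _ _)
      rintro ⟨a, b⟩ (h | h)
      · simp only [Prod.mk.injEq] at h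
        rw [h.1, h.2]
        refine ⟨h2, ?_⟩
        simp [sT]
      · refine ⟨h.1, ?_⟩
        simp only [Equiv.Perm.mul_apply]
        apply sT_step h.2
        rintro ⟨hb, ha⟩
        have := h.1
        rw [← ha, ← hb] at h2
        simp only [perm_inv_self] at h2
        simp only at this
        omega
    rw [h3, Set.ncard_insert_of_notMem _ (Invs_wR_finite n S), h1, Finset.card_insert_of_notMem hpS]
    rintro ⟨_, h5⟩
    simp at h5

theorem len_ge_of_word {w : Equiv.Perm ℤ} (h : ∃ l : List ℤ, (l.map sT).prod = w) :
    (Invs w).ncard ≤ len w := by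
  obtain ⟨l, hl⟩ := h
  have hne : {m : ℕ | ∃ l : List ℤ, l.length = m ∧ (l.map sT).prod = w}.Nonempty := ⟨_, l, rfl, hl⟩
  obtain ⟨l', h1, h2⟩ := Nat.sInf_mem hne
  unfold len
  rw [← h1, ← h2]
  exact (Invs_word l').2

theorem len_wR_le (n : ℤ) (D : Finset (ℤ × ℤ)) : len (wR n D) ≤ D.card := by
  obtain ⟨l, h1, h2⟩ := wR_word n D
  rw [← h1]
  exact Nat.sInf_le ⟨l, rfl, h2⟩

theorem len_red {n : ℤ} {D : Finset (ℤ × ℤ)} (hD : Red n D) : len (wR n D) = D.card := by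
  apply le_antisymm (len_wR_le n D)
  rw [← Invs_red hD]
  obtain ⟨l, _, h2⟩ := wR_word n D
  exact len_ge_of_word ⟨l, h2⟩

theorem lo_ne_hi (n : ℤ) (D : Finset (ℤ × ℤ)) (p : ℤ × ℤ) : lo n D p ≠ hi n D p := by
  unfold lo hi
  intro h
  have := (wR n (aft D p))⁻¹.injective h
  omega

theorem insert_not_red_len {n : ℤ} {D : Finset (ℤ × ℤ)} (h : ¬ Red n D) : len (wR n D) < D.card := by
  unfold Red at h
  push Not at h
  obtain ⟨p, hp, hle⟩ := h
  have hlt : hi n D p < lo n D p := lt_of_le_of_ne hle (Ne.symm (lo_ne_hi n D p))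
  obtain ⟨q, hq, h1, h2⟩ := exists_cross (aft D p) (lo n D p) (hi n D p) hlt (by
    rw [wR_aft_lo, wR_aft_hi]; omega)
  obtain ⟨hqD, hpq⟩ := mem_aft.1 hq
  have hqp : q ≠ p := fun h => rlt_irrefl p (h ▸ hpq)
  have hlq : lo n D q = hi n D p := by
    rw [← h1]; unfold lo; rw [aft_aft hpq]
  have hhq : hi n D q = lo n D p := by
    rw [← h2]; unfold hi; rw [aft_aft hpq]
  set E := (D.erase q).erase p with hE
  have hpE : p ∉ E := by simp [hE]
  have hqE : q ∉ insert p E := by simp [hE, hqp]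
  have hD : D = insert q (insert p E) := by
    rw [hE, Finset.insert_erase (by simp [hp, hqp.symm]), Finset.insert_erase hqD]
  have e1 : lo n (insert p E) q = hi n D p := by
    rw [← hlq, hD]; exact (lo_insert_of_not (rlt_irrefl q)).symm
  have e2 : hi n (insert p E) q = lo n D p := by
    rw [← hhq, hD]; exact (hi_insert_of_not (rlt_irrefl q)).symm
  have e3 : lo n D p = Equiv.swap (hi n D p) (lo n D p) (lo n (insert p E) p) := by
    conv_lhs => rw [hD]
    rw [lo_insert_of_rlt hqE hpq, e1, e2]
  have e4 : hi n D p = Equiv.swap (hi n D p) (lo n D p) (hi n (insert p E) p) := by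
    conv_lhs => rw [hD]
    rw [hi_insert_of_rlt hqE hpq, e1, e2]
  have e5 : lo n (insert p E) p = hi n D p := by
    apply (Equiv.swap (hi n D p) (lo n D p)).injective
    rw [← e3, Equiv.swap_apply_left]
  have e6 : hi n (insert p E) p = lo n D p := by
    apply (Equiv.swap (hi n D p) (lo n D p)).injective
    rw [← e4, Equiv.swap_apply_right]
  rw [lo_insert_of_not (rlt_irrefl p)] at e5
  rw [hi_insert_of_not (rlt_irrefl p)] at e6
  have hw : wR n D = wR n E := by
    conv_lhs => rw [hD]
    rw [wR_insert n _ q hqE, wR_insert n _ p hpE, e1, e2, e5, e6, mul_assoc, Equiv.swap_mul_self,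
      mul_one]
  have hc : D.card = E.card + 2 := by
    conv_lhs => rw [hD]
    rw [Finset.card_insert_of_notMem hqE, Finset.card_insert_of_notMem hpE]
  have := len_wR_le n E
  rw [hw]; omega

theorem len_iff_red {n : ℤ} {D : Finset (ℤ × ℤ)} : len (wR n D) = D.card ↔ Red n D := by
  constructor
  · intro h
    by_contra hc
    have := insert_not_red_len hc
    omega
  · exact len_red

theorem Invs_swap_lt {w : Equiv.Perm ℤ} {a b : ℤ} (hab : a < b) (hw : w a < w b)
    (hf : (Invs (w * Equiv.swap a b)).Finite) :
    (Invs w).ncard < (Invs (w * Equiv.swap a b)).ncard := by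
  set t := Equiv.swap a b with ht
  have htt : ∀ x, t (t x) = x := fun x => by simp [ht]
  have hmem : (a, b) ∈ Invs (w * t) := by
    refine ⟨hab, ?_⟩
    simp only [ht, Equiv.Perm.mul_apply, Equiv.swap_apply_right, Equiv.swap_apply_left]
    exact hw
  have hta : t a = b := by simp [ht]
  have htb : t b = a := by simp [ht]
  have hto : ∀ x, x ≠ a → x ≠ b → t x = x := fun x h1 h2 => Equiv.swap_apply_of_ne_of_ne h1 h2
  have key : (Invs w).ncard ≤ (Invs (w * t) \ {(a, b)}).ncard := by
    apply Set.ncard_le_ncard_of_injOn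
      (fun x : ℤ × ℤ => if t x.1 < t x.2 then (t x.1, t x.2) else x) ?_ ?_ (hf.subset Set.diff_subset)
    · rintro ⟨i, j⟩ ⟨h1, h2⟩
      simp only at h1 h2 ⊢
      split_ifs with h
      · refine ⟨⟨h, ?_⟩, ?_⟩
        · simp only [Equiv.Perm.mul_apply, htt]; exact h2
        · simp only [Set.mem_singleton_iff, Prod.mk.injEq]
          rintro ⟨h3, h4⟩
          have h5 : i = b := by rw [← htt i, h3, hta]
          have h6 : j = a := by rw [← htt j, h4, htb]
          omega
      · refine ⟨⟨h1, ?_⟩, ?_⟩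
        · simp only [Equiv.Perm.mul_apply]
          by_cases hia : i = a
          · subst hia
            by_cases hjb : j = b
            · subst hjb; omega
            · rw [hto j (by omega) hjb, hta]; omega
          · by_cases hib : i = b
            · subst hib
              rw [htb, hto j (by omega) (by omega)] at h
              omega
            · by_cases hja : j = a
              · subst hja
                rw [hta, hto i hia hib] at h
                omega
              · by_cases hjb : j = b
                · subst hjb
                  rw [hto i hia hib, htb]; omega
                · rw [hto i hia hib, hto j hja hjb]; exact h2
        · simp only [Set.mem_singleton_iff, Prod.mk.injEq]
          rintro ⟨rfl, rfl⟩
          omega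
    · rintro ⟨i, j⟩ ⟨h1, _⟩ ⟨i', j'⟩ ⟨h1', _⟩ heq
      simp only at h1 h1' heq
      split_ifs at heq with h h' h'
      · simp only [Prod.mk.injEq] at heq
        rw [t.injective heq.1, t.injective heq.2]
      · simp only [Prod.mk.injEq] at heq
        rw [← heq.1, ← heq.2, htt, htt] at h'
        omega
      · simp only [Prod.mk.injEq] at heq
        rw [heq.1, heq.2, htt, htt] at h
        omega
      · exact heq
  have := Set.ncard_diff_singleton_lt_of_mem hmem hf
  omega

/-! ## Strand labels -/

theorem jx_mk (n i k : ℤ) : jx n (i, k) = i + k - n - 1 := rfl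

theorem aft_split_inv {n : ℤ} {D : Finset (ℤ × ℤ)} {p q : ℤ × ℤ} (hpq : rlt p q) (y : ℤ)
    (h : ∀ x ∈ D, rlt p x → rlt x q → jx n x ≠ y ∧ jx n x + 1 ≠ y) :
    (wR n (aft D p))⁻¹ y =
      (wR n (aft D q))⁻¹ (if q ∈ D then sT (jx n q) y else y) := by
  set A := D.filter (fun x => rlt p x ∧ rlt x q) with hA
  have hfix : (wR n A)⁻¹ y = y := by
    apply wR_fix_inv
    intro x hx
    obtain ⟨h1, h2, h3⟩ := Finset.mem_filter.1 hx
    exact h x h1 h2 h3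
  split_ifs with hq
  · have e : aft D p = A ∪ insert q (aft D q) := by
      ext x
      simp only [mem_aft, Finset.mem_union, Finset.mem_insert, hA, Finset.mem_filter]
      constructor
      · rintro ⟨h1, h2⟩
        rcases rlt_tri x q with h3 | h3 | h3
        · exact Or.inl ⟨h1, h2, h3⟩
        · exact Or.inr (Or.inl h3)
        · exact Or.inr (Or.inr ⟨h1, h3⟩)
      · rintro (⟨h1, h2, _⟩ | rfl | ⟨h1, h2⟩)
        · exact ⟨h1, h2⟩
        · exact ⟨hq, hpq⟩
        · exact ⟨h1, rlt_trans hpq h2⟩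
    rw [e, wR_union, wR_insert_first, mul_inv_rev, mul_inv_rev, Equiv.Perm.mul_apply,
      Equiv.Perm.mul_apply, hfix]
    · unfold sT; rw [Equiv.swap_inv]
    · intro x hx; exact (mem_aft.1 hx).2
    · intro x hx z hz
      obtain ⟨_, _, h3⟩ := Finset.mem_filter.1 hx
      rcases Finset.mem_insert.1 hz with rfl | hz
      · exact h3
      · exact rlt_trans h3 (mem_aft.1 hz).2
  · have e : aft D p = A ∪ aft D q := by
      ext x
      simp only [mem_aft, Finset.mem_union, hA, Finset.mem_filter]
      constructor
      · rintro ⟨h1, h2⟩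
        rcases rlt_tri x q with h3 | h3 | h3
        · exact Or.inl ⟨h1, h2, h3⟩
        · exact absurd (h3 ▸ h1) hq
        · exact Or.inr ⟨h1, h3⟩
      · rintro (⟨h1, h2, _⟩ | ⟨h1, h2⟩)
        · exact ⟨h1, h2⟩
        · exact ⟨h1, rlt_trans hpq h2⟩
    rw [e, wR_union, mul_inv_rev, Equiv.Perm.mul_apply, hfix]
    intro x hx z hz
    obtain ⟨_, _, h3⟩ := Finset.mem_filter.1 hx
    exact rlt_trans h3 (mem_aft.1 hz).2

theorem lab_eq {n : ℤ} {D : Finset (ℤ × ℤ)} (hg : ∀ p ∈ D, p.1 ≤ n ∧ 1 ≤ p.2) :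
    ∀ (N : ℕ) (i k : ℤ), i ≤ n → (n - i).toNat + k.toNat = N →
      lab n D true i k = hi n D (i, k) ∧ lab n D false i k = lo n D (i, k) := by
  intro N
  induction N using Nat.strong_induction_on with
  | _ N ih =>
    intro i k hi' hN
    have rec1 : i < n → lab n D true (i + 1) k = hi n D (i + 1, k) ∧
        lab n D false (i + 1) k = lo n D (i + 1, k) := fun h =>
      ih _ (by omega) (i + 1) k (by omega) rfl
    have rec2 : 0 < k → lab n D true i (k - 1) = hi n D (i, k - 1) ∧
        lab n D false i (k - 1) = lo n D (i, k - 1) := fun h =>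
      ih _ (by omega) i (k - 1) hi' rfl
    constructor
    · rw [lab]
      split_ifs with h1 h2
      · have : i = n := by omega
        subst this
        unfold hi
        rw [wR_fix_inv, jx_mk]
        · ring
        · intro p hp
          obtain ⟨h3, h4⟩ := mem_aft.1 hp
          have := hg p h3
          unfold rlt at h4; unfold jx
          simp only at h4 ⊢
          omega
      · rw [(rec1 (by omega)).1]
        unfold hi
        rw [aft_split_inv (p := (i, k)) (q := (i + 1, k)), if_pos h2, jx_mk, jx_mk, sT]
        · congr 1
          rw [show i + k - n - 1 + 1 = i + 1 + k - n - 1 by ring, Equiv.swap_apply_left]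
        · unfold rlt; simp
        · intro x _ h3 h4; unfold rlt at h3 h4; simp only at h3 h4; omega
      · rw [(rec1 (by omega)).2]
        unfold hi lo
        rw [aft_split_inv (p := (i, k)) (q := (i + 1, k)), if_neg h2, jx_mk, jx_mk]
        · congr 1; ring
        · unfold rlt; simp
        · intro x _ h3 h4; unfold rlt at h3 h4; simp only at h3 h4; omega
    · rw [lab]
      split_ifs with h1 h2
      · unfold lo
        rw [wR_fix_inv, jx_mk]
        intro p hp
        obtain ⟨h3, h4⟩ := mem_aft.1 hp
        have := hg p h3
        unfold rlt at h4
        simp only at h4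
        omega
      · rw [(rec2 (by omega)).2]
        unfold lo
        rw [aft_split_inv (p := (i, k)) (q := (i, k - 1)), if_pos h2, jx_mk, jx_mk, sT]
        · congr 1
          rw [show i + k - n - 1 = i + (k - 1) - n - 1 + 1 by ring, Equiv.swap_apply_right]
        · unfold rlt; simp
        · intro x _ h3 h4; unfold rlt at h3 h4; unfold jx; simp only at h3 h4 ⊢; omega
      · rw [(rec2 (by omega)).1]
        unfold lo hi
        rw [aft_split_inv (p := (i, k)) (q := (i, k - 1)), if_neg h2, jx_mk, jx_mk]
        · congr 1; ring
        · unfold rlt; simp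
        · intro x _ h3 h4; unfold rlt at h3 h4; unfold jx; simp only at h3 h4 ⊢; omega

/-! ## Good diagrams -/

/-- increasing on nonpositive labels -/
def StarS (n : ℤ) (D : Finset (ℤ × ℤ)) : Prop :=
  ∀ x y : ℤ, x < y → y ≤ 0 → wR n D x < wR n D y

/-- a reduced diagram satisfying (*) in rows `1..n` -/
structure Good (n : ℤ) (D : Finset (ℤ × ℤ)) : Prop where
  grid : ∀ q ∈ D, q.1 ≤ n ∧ 1 ≤ q.2 ∧ q.2 ≤ n
  red : Red n D
  star : StarS n D

theorem Good.labT {n : ℤ} {D : Finset (ℤ × ℤ)} (hg : ∀ q ∈ D, q.1 ≤ n ∧ 1 ≤ q.2 ∧ q.2 ≤ n)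
    {p : ℤ × ℤ} (hp : p.1 ≤ n) : lab n D true p.1 p.2 = hi n D p :=
  (lab_eq (fun q hq => ⟨(hg q hq).1, (hg q hq).2.1⟩) _ p.1 p.2 hp rfl).1

theorem Good.labF {n : ℤ} {D : Finset (ℤ × ℤ)} (hg : ∀ q ∈ D, q.1 ≤ n ∧ 1 ≤ q.2 ∧ q.2 ≤ n)
    {p : ℤ × ℤ} (hp : p.1 ≤ n) : lab n D false p.1 p.2 = lo n D p :=
  (lab_eq (fun q hq => ⟨(hg q hq).1, (hg q hq).2.1⟩) _ p.1 p.2 hp rfl).2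

theorem Good.isRC {n : ℤ} {D : Finset (ℤ × ℤ)} (h : Good n D) : IsRC n D :=
  ⟨fun q hq => ⟨(h.grid q hq).1, (h.grid q hq).2.2⟩, len_red h.red⟩

theorem cross_inv {n : ℤ} {D : Finset (ℤ × ℤ)} (hD : Red n D) {p : ℤ × ℤ} (hp : p ∈ D) :
    wR n D (hi n D p) < wR n D (lo n D p) := by
  have hX : Low (insert p (aft D p)) D := by
    refine ⟨fun x hx => ?_, fun x hx y hy hxy => ?_⟩
    · rcases Finset.mem_insert.1 hx with rfl | hx
      · exact hp
      · exact (mem_aft.1 hx).1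
    · refine Finset.mem_insert_of_mem (mem_aft.2 ⟨hy, ?_⟩)
      rcases Finset.mem_insert.1 hx with rfl | hx
      · exact hxy
      · exact rlt_trans (mem_aft.1 hx).2 hxy
  apply inv_mono hD _ hX _ _ (hD p hp)
  rw [wR_insert_first n p _ (fun x hx => (mem_aft.1 hx).2), Equiv.Perm.mul_apply,
      Equiv.Perm.mul_apply, wR_aft_lo, wR_aft_hi]
  simp [sT]

theorem Good.hi_pos {n : ℤ} {D : Finset (ℤ × ℤ)} (h : Good n D) {p : ℤ × ℤ} (hp : p ∈ D) :
    0 < hi n D p := by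
  by_contra hc
  have h1 := cross_inv h.red hp
  have h2 := h.star _ _ (h.red p hp) (by omega)
  omega

theorem Good.level {n : ℤ} {D : Finset (ℤ × ℤ)} (h : Good n D) (l : ℤ) {x y : ℤ} (hxy : x < y)
    (hy : y ≤ 0) : V n D l x < V n D l y := by
  by_contra hc
  have hne : V n D l y ≠ V n D l x := fun h' => by
    have := (V n D l).injective h'; omega
  have h1 := inv_mono h.red _ (low_rows D l) y x hxy (lt_of_le_of_ne (not_lt.1 hc) hne)
  have h2 := h.star x y hxy hy
  omega

theorem V_mono {n : ℤ} {D : Finset (ℤ × ℤ)} (hD : Red n D) {l l' : ℤ} (hl : l ≤ l') {a b : ℤ}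
    (hab : b < a) (h : V n D l a < V n D l b) : V n D l' a < V n D l' b :=
  inv_mono ((low_rows D l').red hD) _ (low_rows_rows D hl) a b hab h

/-- the strand immediately to the left of `b` at level `l` is positive -/
def gap (n : ℤ) (D : Finset (ℤ × ℤ)) (l b : ℤ) : Prop := 0 < (V n D l)⁻¹ (V n D l b + 1)

theorem gap_persist {n : ℤ} {D : Finset (ℤ × ℤ)} (h : Good n D) {k l a b : ℤ} (hb : b ≤ 0)
    (ha : 0 < a) (hk : V n D k a = V n D k b + 1) (hkl : k ≤ l) (hl : V n D l b < V n D l a) :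
    gap n D l b := by
  unfold gap
  by_contra hc
  set x := (V n D l)⁻¹ (V n D l b + 1) with hx
  have hVx : V n D l x = V n D l b + 1 := by simp [hx]
  have hbx : b < x := by
    rcases lt_trichotomy b x with h1 | h1 | h1
    · exact h1
    · rw [← h1] at hVx; omega
    · have := h.level l h1 hb; omega
  have h1 := h.level k hbx (by omega)
  have h2 : V n D k x ≠ V n D k a := fun h' => by
    have := (V n D k).injective h'; omega
  have h3 := V_mono h.red hkl (a := a) (b := x) (by omega) (by omega)
  omega

theorem aft_V_inv {n : ℤ} {D : Finset (ℤ × ℤ)} (p : ℤ × ℤ) {y : ℤ} (hy : y ≤ jx n p) :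
    (wR n (aft D p))⁻¹ y = (V n D (p.2 - 1))⁻¹ y := by
  have e : aft D p = (D.filter fun q => q.2 = p.2 ∧ p.1 < q.1) ∪ rows D (p.2 - 1) := by
    ext x
    simp only [mem_aft, Finset.mem_union, Finset.mem_filter, mem_rows, rlt]
    constructor
    · rintro ⟨h1, h2⟩
      by_cases h : x.2 < p.2
      · exact Or.inr ⟨h1, by omega⟩
      · exact Or.inl ⟨h1, by omega⟩
    · rintro (⟨h1, h2⟩ | ⟨h1, h2⟩)
      · exact ⟨h1, by omega⟩
      · exact ⟨h1, by omega⟩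
  rw [e, wR_union, mul_inv_rev, Equiv.Perm.mul_apply,
    wR_fix_inv n (D.filter fun q => q.2 = p.2 ∧ p.1 < q.1) y]
  · rfl
  · intro q hq
    have := (Finset.mem_filter.1 hq).2
    unfold jx at *; omega
  · intro x hx y hy
    have h1 := (Finset.mem_filter.1 hx).2
    have h2 := (mem_rows.1 hy).2
    unfold rlt; omega

theorem aft_step {D : Finset (ℤ × ℤ)} {i k : ℤ} (h : (i, k) ∉ D) : aft D (i - 1, k) = aft D (i, k) := by
  ext x
  simp only [mem_aft, rlt]
  constructor
  · rintro ⟨h1, h2⟩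
    refine ⟨h1, ?_⟩
    have : ¬ (x.1 = i ∧ x.2 = k) := fun h' => h (by rw [← h'.1, ← h'.2]; exact h1)
    omega
  · rintro ⟨h1, h2⟩; exact ⟨h1, by omega⟩

theorem Good.run {n : ℤ} {D : Finset (ℤ × ℤ)} (h : Good n D) {i k : ℤ} (hp : (i, k) ∉ D) (r : ℕ)
    (hr : ∀ s : ℕ, s < r → (wR n (aft D (i, k)))⁻¹ (jx n (i, k) - s) ≤ 0) :
    ∀ s : ℕ, s ≤ r → (i - s, k) ∉ D ∧ aft D (i - s, k) = aft D (i, k) := by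
  intro s
  induction s with
  | zero => intro _; simpa using hp
  | succ s ih =>
    intro hs
    obtain ⟨h1, h2⟩ := ih (by omega)
    have e : aft D (i - (s + 1 : ℕ), k) = aft D (i, k) := by
      rw [← h2, ← aft_step h1]; congr 2; push_cast; ring
    refine ⟨fun hc => ?_, e⟩
    have h3 := h.hi_pos hc
    have h4 := hr s (by omega)
    unfold hi at h3
    rw [e] at h3
    have e2 : jx n (i - (s + 1 : ℕ), k) + 1 = jx n (i, k) - s := by
      unfold jx; push_cast; ring
    rw [e2] at h3
    omega

theorem Good.V_open {n : ℤ} {D : Finset (ℤ × ℤ)} (h : Good n D) {p : ℤ × ℤ} (hp : p ∉ D)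
    (hlo : lo n D p ≤ 0) : V n D p.2 (lo n D p) = jx n p ∧ V n D p.2 (hi n D p) = jx n p + 1 := by
  obtain ⟨i, k⟩ := p
  have hrun := (h.run hp 1 (by
    intro s hs
    have : s = 0 := by omega
    subst this
    simpa [lo] using hlo) 1 le_rfl).1
  simp only [Nat.cast_one] at hrun
  have e : rows D k = (D.filter fun q => q.2 = k ∧ q.1 < i) ∪ aft D (i, k) := by
    ext x
    simp only [mem_aft, Finset.mem_union, Finset.mem_filter, mem_rows, rlt]
    constructor
    · rintro ⟨h1, h2⟩
      have : ¬ (x.1 = i ∧ x.2 = k) := fun h' => hp (by rw [← h'.1, ← h'.2]; exact h1)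
      by_cases h : x.2 = k ∧ x.1 < i
      · exact Or.inl ⟨h1, h⟩
      · exact Or.inr ⟨h1, by omega⟩
    · rintro (⟨h1, h2⟩ | ⟨h1, h2⟩)
      · exact ⟨h1, by omega⟩
      · exact ⟨h1, by omega⟩
  have hA : ∀ y, jx n (i, k) ≤ y → wR n (D.filter fun q => q.2 = k ∧ q.1 < i) y = y := by
    intro y hy
    apply wR_fix
    intro q hq
    obtain ⟨h1, h2, h3⟩ := Finset.mem_filter.1 hq
    have : ¬ (q.1 = i - 1 ∧ q.2 = k) := fun h' => hrun (by rw [← h'.1, ← h'.2]; exact h1)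
    unfold jx at *; simp only at hy; omega
  unfold V
  simp only
  rw [e, wR_union, Equiv.Perm.mul_apply, Equiv.Perm.mul_apply, wR_aft_lo, wR_aft_hi, hA _ le_rfl,
    hA _ (by omega)]
  · exact ⟨rfl, rfl⟩
  · intro x hx y hy
    have h1 := (Finset.mem_filter.1 hx).2
    have h2 := (mem_aft.1 hy).2
    unfold rlt at *; simp only at h2; omega

/-! ## One forward step of the insertion -/

theorem openSpace_iff {n : ℤ} {D : Finset (ℤ × ℤ)} (h : Good n D) {i k : ℤ} :
    OpenSpace n D i k ↔ i ≤ n ∧ (i, k) ∉ D ∧ lo n D (i, k) ≤ 0 ∧ 0 < hi n D (i, k) := by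
  unfold OpenSpace
  constructor
  · rintro ⟨h1, h2, h3, h4⟩
    rw [← Good.labT h.grid (p := (i, k)) h1, ← Good.labF h.grid (p := (i, k)) h1]
    exact ⟨h1, h2, h3, h4⟩
  · rintro ⟨h1, h2, h3, h4⟩
    rw [← Good.labT h.grid (p := (i, k)) h1] at h4
    rw [← Good.labF h.grid (p := (i, k)) h1] at h3
    exact ⟨h1, h2, h3, h4⟩

theorem sInf_eq_of {s : Set ℤ} {i : ℤ} (h1 : i ∈ s) (h2 : ∀ x ∈ s, i ≤ x) : sInf s = i := by
  have hb : BddBelow s := ⟨i, h2⟩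
  exact le_antisymm (csInf_le hb h1) (le_csInf ⟨i, h1⟩ h2)

theorem fwd_step {n : ℤ} {D : Finset (ℤ × ℤ)} (h : Good n D) {i k : ℤ} (hp : (i, k) ∉ D)
    (hi' : i ≤ n) (hk : 1 ≤ k ∧ k ≤ n) (hlo : lo n D (i, k) ≤ 0) (hhi : 0 < hi n D (i, k)) (r : ℕ)
    (hr0 : 1 ≤ r)
    (hr : ∀ s : ℕ, s < r → (wR n (aft D (i, k)))⁻¹ (jx n (i, k) - s) ≤ 0)
    (hr' : 0 < (wR n (aft D (i, k)))⁻¹ (jx n (i, k) - r))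
    {p' : ℤ × ℤ} (hp' : p' ∈ D) (h1 : lo n D p' = hi n D (i - r, k)) (h2 : hi n D p' = lo n D (i - r, k))
    (h3 : p'.2 < k) (f : ℕ) :
    insertSteps n (f + 1) (insert (i - (r : ℤ), k) D) p' =
      (insert (i - (r : ℤ), k) D, p') :: insertSteps n f (insert (i, k) D) (i, k) := by
  have hrun := h.run hp r hr
  set q : ℤ × ℤ := (i - (r : ℤ), k) with hq
  have hqD : q ∉ D := (hrun r le_rfl).1
  have hgS : ∀ x ∈ insert q D, x.1 ≤ n ∧ 1 ≤ x.2 ∧ x.2 ≤ n := by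
    intro x hx
    rcases Finset.mem_insert.1 hx with rfl | hx
    · refine ⟨?_, hk.1, hk.2⟩
      simp only [hq]; omega
    · exact h.grid x hx
  have hqp' : rlt q p' := Or.inl h3
  have hloq : 0 < lo n D q := by
    unfold lo; rw [(hrun r le_rfl).2]
    have : jx n q = jx n (i, k) - r := by simp [hq, jx]; ring
    rw [this]; exact hr'
  have hhiq : hi n D q ≤ 0 := by
    unfold hi; rw [(hrun r le_rfl).2]
    have : jx n q + 1 = jx n (i, k) - (r - 1 : ℕ) := by
      simp only [hq, jx]; push_cast [hr0]; ring
    rw [this]; exact hr _ (by omega)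
  have hnot : ¬ IsRC n (insert q D) := by
    intro hc
    have hR := len_iff_red.1 hc.2 q (Finset.mem_insert_self _ _)
    rw [lo_insert_of_not (rlt_irrefl q), hi_insert_of_not (rlt_irrefl q)] at hR
    omega
  have hT : ∀ x ∈ insert q D, lab n (insert q D) true x.1 x.2 = hi n (insert q D) x := fun x hx =>
    Good.labT hgS (hgS x hx).1
  have hF : ∀ x ∈ insert q D, lab n (insert q D) false x.1 x.2 = lo n (insert q D) x := fun x hx =>
    Good.labF hgS (hgS x hx).1
  have hp'S : p' ∈ insert q D := Finset.mem_insert_of_mem hp'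
  have ea : lab n (insert q D) true p'.1 p'.2 = lo n D q := by
    rw [hT p' hp'S, hi_insert_of_not (rlt_asymm hqp'), h2]
  have eb : lab n (insert q D) false p'.1 p'.2 = hi n D q := by
    rw [hF p' hp'S, lo_insert_of_not (rlt_asymm hqp'), h1]
  have hpair : ∀ x ∈ insert q D, x ≠ p' →
      ((hi n (insert q D) x = lo n D q ∧ lo n (insert q D) x = hi n D q) ∨
        (hi n (insert q D) x = hi n D q ∧ lo n (insert q D) x = lo n D q)) → x = q := by
    intro x hx hxp' hpr
    by_contra hxq
    have hxD : x ∈ D := (Finset.mem_insert.1 hx).resolve_left hxq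
    have hred := h.red x hxD
    have : (hi n D x = lo n D q ∧ lo n D x = hi n D q) ∨
        (hi n D x = hi n D q ∧ lo n D x = lo n D q) := by
      by_cases hxr : rlt x q
      · rw [lo_insert_of_rlt hqD hxr, hi_insert_of_rlt hqD hxr] at hpr
        rcases hpr with ⟨e1, e2⟩ | ⟨e1, e2⟩
        · right
          constructor
          · apply (Equiv.swap (lo n D q) (hi n D q)).injective
            rw [e1, Equiv.swap_apply_right]
          · apply (Equiv.swap (lo n D q) (hi n D q)).injective
            rw [e2, Equiv.swap_apply_left]
        · left
          constructor
          · apply (Equiv.swap (lo n D q) (hi n D q)).injective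
            rw [e1, Equiv.swap_apply_left]
          · apply (Equiv.swap (lo n D q) (hi n D q)).injective
            rw [e2, Equiv.swap_apply_right]
      · rw [lo_insert_of_not hxr, hi_insert_of_not hxr] at hpr
        exact hpr
    rcases this with ⟨e1, e2⟩ | ⟨e1, e2⟩
    · exact hxp' (cross_unique h.red hxD hp' (by rw [e2, h1]) (by rw [e1, h2]))
    · omega
  rw [insertSteps]
  simp only [if_neg hnot]
  have hC : ((insert q D).filter fun x =>
            x ≠ p' ∧ ((lab n (insert q D) true x.1 x.2 = lab n (insert q D) true p'.1 p'.2 ∧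
              lab n (insert q D) false x.1 x.2 = lab n (insert q D) false p'.1 p'.2) ∨
                     (lab n (insert q D) true x.1 x.2 = lab n (insert q D) false p'.1 p'.2 ∧
              lab n (insert q D) false x.1 x.2 = lab n (insert q D) true p'.1 p'.2))) = {q} := by
    ext x
    simp only [Finset.mem_filter, Finset.mem_singleton, ea, eb]
    constructor
    · rintro ⟨hx, hxp, hpr⟩
      rw [hT x hx, hF x hx] at hpr
      exact hpair x hx hxp hpr
    · rintro rfl
      have hqS := Finset.mem_insert_self q D
      refine ⟨hqS, fun hc => hqD (hc ▸ hp'), Or.inr ?_⟩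
      rw [hT q hqS, hF q hqS, lo_insert_of_not (rlt_irrefl q), hi_insert_of_not (rlt_irrefl q)]
      exact ⟨rfl, rfl⟩
  rw [hC]
  simp only [Finset.sort_singleton, List.headI]
  rw [Finset.erase_insert hqD]
  have hs : sInf {x : ℤ | q.1 < x ∧ OpenSpace n D x q.2} = i := by
    apply sInf_eq_of
    · refine ⟨?_, (openSpace_iff h).2 ⟨hi', hp, hlo, hhi⟩⟩
      simp only [hq]; omega
    · rintro x ⟨hx1, hx2⟩
      by_contra hc
      obtain ⟨_, _, _, hx3⟩ := (openSpace_iff h).1 hx2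
      simp only [hq] at hx1 hx3
      obtain ⟨s, hs⟩ : ∃ s : ℕ, i - x = s + 1 := ⟨(i - x - 1).toNat, by omega⟩
      have hxe : x = i - (s + 1 : ℕ) := by push_cast; omega
      unfold hi at hx3
      rw [hxe, (hrun (s + 1) (by omega)).2] at hx3
      have e : jx n (i - (s + 1 : ℕ), k) + 1 = jx n (i, k) - s := by
        simp only [jx]; push_cast; ring
      rw [e] at hx3
      have := hr s (by omega)
      omega
  rw [hs]

/-! ## The reverse insertion -/

theorem rev_base {n : ℤ} {D : Finset (ℤ × ℤ)} (h : Good n D) {i k : ℤ} (hp : (i, k) ∉ D)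
    (hi' : i ≤ n) (hlo : lo n D (i, k) ≤ 0) (hhi : 0 < hi n D (i, k))
    (hr : ∀ s : ℕ, (wR n (aft D (i, k)))⁻¹ (jx n (i, k) - s) ≤ 0) :
    sInf {x : ℤ | OpenSpace n D x k} = i := by
  apply sInf_eq_of
  · exact (openSpace_iff h).2 ⟨hi', hp, hlo, hhi⟩
  · intro x hx2
    by_contra hc
    obtain ⟨_, _, _, hx3⟩ := (openSpace_iff h).1 hx2
    obtain ⟨s, hs⟩ : ∃ s : ℕ, i - x = s + 1 := ⟨(i - x - 1).toNat, by omega⟩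
    have hxe : x = i - (s + 1 : ℕ) := by push_cast; omega
    unfold hi at hx3
    rw [hxe, (h.run hp (s + 1) (fun t _ => hr t) (s + 1) le_rfl).2] at hx3
    have e : jx n (i - (s + 1 : ℕ), k) + 1 = jx n (i, k) - s := by
      simp only [jx]; push_cast; ring
    rw [e] at hx3
    have := hr s
    omega

/-- the gap of a smaller strand cuts off a run of nonpositive strands -/
theorem gap_cut {n : ℤ} {D : Finset (ℤ × ℤ)} (h : Good n D) {p : ℤ × ℤ} {b : ℤ}
    (hb : gap n D (p.2 - 1) b) (hlo : lo n D p ≤ 0) (hlt : b < lo n D p) :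
    ∃ s : ℕ, 0 < (wR n (aft D p))⁻¹ (jx n p - s) ∧ V n D (p.2 - 1) b + 1 = jx n p - s := by
  have h1 := h.level (p.2 - 1) hlt hlo
  have h2 : V n D (p.2 - 1) (lo n D p) = jx n p := by
    unfold lo; rw [aft_V_inv p le_rfl]; simp
  refine ⟨(jx n p - (V n D (p.2 - 1) b + 1)).toNat, ?_, by omega⟩
  rw [aft_V_inv p (by omega)]
  unfold gap at hb
  rwa [show jx n p - ((jx n p - (V n D (p.2 - 1) b + 1)).toNat : ℤ) = V n D (p.2 - 1) b + 1 by omega]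

theorem rev {n : ℤ} : ∀ (N : ℕ) (D : Finset (ℤ × ℤ)) (p : ℤ × ℤ), p.2.toNat = N → Good n D → p ∉ D →
    p.1 ≤ n → 1 ≤ p.2 → p.2 ≤ n → lo n D p ≤ 0 → 0 < hi n D p →
    ∃ (R : Finset (ℤ × ℤ)) (a : ℤ), Good n R ∧ wR n R = wR n D ∧ 1 ≤ a ∧ a ≤ p.2 ∧
      (∀ l, p.2 ≤ l → V n R l = V n D l) ∧
      (∃ f : ℕ, (n - p.2).toNat + 1 ≤ f ∧
        ∀ X, (insertSteps n f (insert p D) p).getLast? = some X → insertOne n R a = X.1) ∧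
      (∃ B : ℤ → ℤ, (∀ l, a ≤ l → l < p.2 → B l ≤ lo n D p ∧ gap n R l (B l)) ∧
        (∀ l l', a ≤ l → l ≤ l' → l' < p.2 → B l ≤ B l')) ∧
      (∀ (A : ℤ) (B : ℤ → ℤ), (∀ l, A ≤ l → l < p.2 → gap n D l (B l)) →
        (∀ l l', A ≤ l → l ≤ l' → l' < p.2 → B l ≤ B l') →
        (A < p.2 → B (p.2 - 1) < lo n D p) → a ≤ A) := by
  intro N
  induction N using Nat.strong_induction_on with
  | _ N ih =>
    rintro D ⟨i, k⟩ hN h hp hin hk1 hkn hlo hhi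
    simp only at hN hin hk1 hkn
    by_cases hinf : ∀ s : ℕ, (wR n (aft D (i, k)))⁻¹ (jx n (i, k) - s) ≤ 0
    · refine ⟨D, k, h, rfl, hk1, le_rfl, fun _ _ => rfl, ?_, ?_, ?_⟩
      · refine ⟨(n + 1 - k).toNat + 1, by simp only; omega, ?_⟩
        intro X hX
        unfold insertOne insertStepsOf
        rw [rev_base h hp hin hlo hhi hinf]
        simp only
        rw [hX]; rfl
      · exact ⟨fun _ => 0, fun l h1 h2 => absurd h1 (by simp only at h2; omega),
          fun _ _ _ _ _ => le_rfl⟩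
      · intro A B h1 _ h3
        simp only at h1 h3
        by_contra hc
        obtain ⟨s, hs, _⟩ := gap_cut h (p := (i, k)) (h1 (k - 1) (by omega) (by omega)) hlo (h3 (by omega))
        have := hinf s
        omega
    · push Not at hinf
      classical
      set r := Nat.find hinf with hrdef
      have hr' : 0 < (wR n (aft D (i, k)))⁻¹ (jx n (i, k) - r) := Nat.find_spec hinf
      have hr : ∀ s : ℕ, s < r → (wR n (aft D (i, k)))⁻¹ (jx n (i, k) - s) ≤ 0 := fun s hs =>
        not_lt.1 (Nat.find_min hinf hs)
      have hr0 : 1 ≤ r := by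
        by_contra hc
        have : r = 0 := by omega
        rw [this] at hr'
        unfold lo at hlo
        simp only [Nat.cast_zero, sub_zero] at hr'
        omega
      have hrun := h.run hp r hr
      set q : ℤ × ℤ := (i - (r : ℤ), k) with hq
      have hqD : q ∉ D := (hrun r le_rfl).1
      have jq : jx n q = jx n (i, k) - r := by simp only [hq, jx]; ring
      have hloe : lo n D q = (wR n (aft D (i, k)))⁻¹ (jx n (i, k) - r) := by
        unfold lo; rw [(hrun r le_rfl).2, jq]
      have hhie : hi n D q = (wR n (aft D (i, k)))⁻¹ (jx n (i, k) - (r - 1 : ℕ)) := by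
        unfold hi; rw [(hrun r le_rfl).2, jq]; congr 1; push_cast [hr0]; ring
      have hloq : 0 < lo n D q := by rw [hloe]; exact hr'
      have hhiq : hi n D q ≤ 0 := by rw [hhie]; exact hr _ (by omega)
      have Va : V n D (k - 1) (lo n D q) = jx n (i, k) - r := by
        rw [hloe, aft_V_inv (i, k) (by omega)]; simp
      have Vb : V n D (k - 1) (hi n D q) = jx n (i, k) - (r - 1 : ℕ) := by
        rw [hhie, aft_V_inv (i, k) (by omega)]; simp
      have Vlo : V n D (k - 1) (lo n D (i, k)) = jx n (i, k) := by
        unfold lo; rw [aft_V_inv (i, k) le_rfl]; simp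
      obtain ⟨p', hp'r, h1', h2'⟩ := exists_cross (rows D (k - 1)) (lo n D q) (hi n D q) (by omega) (by
        change V n D (k - 1) _ < V n D (k - 1) _
        rw [Va, Vb]; push_cast [hr0]; omega)
      obtain ⟨hp', hp'k⟩ := mem_rows.1 hp'r
      have h1 : lo n D p' = hi n D q := by rw [← h1']; unfold lo; rw [aft_rows hp'k]
      have h2 : hi n D p' = lo n D q := by rw [← h2']; unfold hi; rw [aft_rows hp'k]
      clear h1' h2'
      have hqp' : rlt q p' := Or.inl (by simp only [hq]; omega)
      have hqne : q ≠ p' := fun hc => hqD (hc ▸ hp')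
      set E := (insert q D).erase p' with hE
      have hp'E : p' ∉ E := by simp [hE]
      have hS : insert p' E = insert q D := Finset.insert_erase (Finset.mem_insert_of_mem hp')
      have hloE : lo n E p' = hi n D q := by
        rw [← lo_insert_of_not (rlt_irrefl p'), hS, lo_insert_of_not (rlt_asymm hqp'), h1]
      have hhiE : hi n E p' = lo n D q := by
        rw [← hi_insert_of_not (rlt_irrefl p'), hS, hi_insert_of_not (rlt_asymm hqp'), h2]
      have hwE : wR n E = wR n D := by
        have e1 := wR_insert n E p' hp'E
        rw [hS, wR_insert n D q hqD, hloE, hhiE, Equiv.swap_comm] at e1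
        exact (mul_right_cancel e1).symm
      have hVge : ∀ l, k ≤ l → V n E l = V n D l := by
        intro l hl
        have e1 := V_insert_of_le (n := n) hp'E (show p'.2 ≤ l by omega)
        rw [hS, V_insert_of_le hqD (show q.2 ≤ l from hl), hloE, hhiE, Equiv.swap_comm] at e1
        exact (mul_right_cancel e1).symm
      have hVlt : ∀ l, l < p'.2 → V n E l = V n D l := by
        intro l hl
        have e1 := V_insert_of_lt (n := n) (D := E) hl
        rw [hS, V_insert_of_lt (show l < q.2 by simp only [hq]; omega)] at e1
        exact e1.symm
      have hVmid : V n D (k - 1) = V n E (k - 1) * Equiv.swap (hi n D q) (lo n D q) := by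
        have e1 := V_insert_of_le (n := n) hp'E hp'k
        rw [hS, V_insert_of_lt (show k - 1 < q.2 by simp only [hq]; omega), hloE, hhiE] at e1
        exact e1
      have hcard : E.card = D.card := by
        have e1 := Finset.card_insert_of_notMem hp'E
        rw [hS, Finset.card_insert_of_notMem hqD] at e1
        omega
      have hGE : Good n E := by
        refine ⟨?_, ?_, ?_⟩
        · intro x hx
          rcases Finset.mem_insert.1 (Finset.mem_of_mem_erase hx) with rfl | hx
          · refine ⟨?_, hk1, hkn⟩
            simp only [hq]; omega
          · exact h.grid x hx
        · apply len_iff_red.1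
          rw [hwE, hcard]; exact len_red h.red
        · intro x y hxy hy
          rw [hwE]; exact h.star x y hxy hy
      have hgp' := h.grid p' hp'
      obtain ⟨R, a, hGR, hwR, ha1, hak, hVR, ⟨f, hf, hfX⟩, ⟨B, hB1, hB2⟩, hmono⟩ :=
        ih p'.2.toNat (by omega) E p' rfl hGE hp'E hgp'.1 hgp'.2.1 hgp'.2.2 (by omega) (by omega)
      have hble : hi n D q ≤ lo n D (i, k) := by
        by_contra hc
        have := h.level (k - 1) (not_le.1 hc) hhiq
        rw [Vlo, Vb] at this
        omega
      have hgapE : ∀ l, p'.2 ≤ l → l < k → gap n R l (hi n D q) := by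
        intro l hl1 hl2
        unfold gap
        rw [hVR l hl1]
        have ho := hGE.V_open hp'E (by omega)
        rw [hloE, hhiE] at ho
        apply gap_persist hGE hhiq hloq (k := p'.2) (by rw [ho.1, ho.2]) hl1
        by_contra hc
        have hne : V n E l (lo n D q) ≠ V n E l (hi n D q) := fun h' => by
          have := (V n E l).injective h'; omega
        have h5 := V_mono hGE.red (show l ≤ k - 1 by omega) (a := lo n D q) (b := hi n D q) (by omega)
          (lt_of_le_of_ne (not_lt.1 hc) hne)
        have h6 : V n D (k - 1) (lo n D q) < V n D (k - 1) (hi n D q) := by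
          rw [Va, Vb]; push_cast [hr0]; omega
        rw [hVmid] at h6
        simp only [Equiv.Perm.mul_apply, Equiv.swap_apply_left, Equiv.swap_apply_right] at h6
        omega
      refine ⟨R, a, hGR, hwR.trans hwE, ha1, by simp only; omega, ?_, ?_, ?_, ?_⟩
      · intro l hl
        simp only at hl
        rw [hVR l (by omega), hVge l hl]
      · obtain ⟨f', rfl⟩ : ∃ f' : ℕ, f = f' + 1 := ⟨f - 1, by omega⟩
        refine ⟨f', by simp only; omega, ?_⟩
        intro X hX
        apply hfX X
        rw [hS, hq, fwd_step h hp hin ⟨hk1, hkn⟩ hlo hhi r hr0 hr hr' hp' h1 h2 (by omega) f']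
        rw [List.getLast?_cons, hX]; rfl
      · refine ⟨fun l => if l < p'.2 then B l else hi n D q, ?_, ?_⟩
        · intro l hl1 hl2
          simp only at hl2
          simp only
          split_ifs with hl
          · have := hB1 l hl1 hl
            rw [hloE] at this
            exact ⟨this.1.trans hble, this.2⟩
          · exact ⟨hble, hgapE l (by omega) hl2⟩
        · intro l l' hl1 hl2 hl3
          simp only
          split_ifs with hl hl'
          · exact hB2 l l' hl1 hl2 hl'
          · have := (hB1 l hl1 hl).1
            omega
          · omega
          · exact le_rfl
      · intro A B' hB'1 hB'2 hB'3
        simp only at hB'1 hB'2 hB'3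
        by_cases hA : k ≤ A
        · omega
        · have hg := hB'1 (k - 1) (by omega) (by omega)
          obtain ⟨s, hs1, hs2⟩ := gap_cut h (p := (i, k)) hg hlo (hB'3 (by omega))
          have hsr : r ≤ s := by
            by_contra hc
            have := hr s (by omega)
            omega
          have hlt : B' (k - 1) < hi n D q := by
            by_contra hc
            have h5 : V n D (k - 1) (hi n D q) ≤ V n D (k - 1) (B' (k - 1)) := by
              rcases eq_or_lt_of_le (not_lt.1 hc) with h6 | h6
              · rw [h6]
              · exact (h.level (k - 1) h6 (by have := hB'3 (by omega); omega)).le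
            rw [Vb] at h5
            simp only at hs2
            omega
          apply hmono A B'
          · intro l hl1 hl2
            unfold gap
            rw [hVlt l hl2]
            exact hB'1 l hl1 (by omega)
          · intro l l' hl1 hl2 hl3
            exact hB'2 l l' hl1 hl2 (by omega)
          · intro hA'
            rw [hloE]
            have := hB'2 (p'.2 - 1) (k - 1) (by omega) (by omega) (by omega)
            omega

theorem swap_word_aux (a : ℤ) (k : ℕ) : ∃ l : List ℤ, (l.map sT).prod = Equiv.swap a (a + k) := by
  induction k with
  | zero => exact ⟨[], by simp; rfl⟩
  | succ k ih =>
    obtain ⟨l, hl⟩ := ih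
    by_cases hk : k = 0
    · subst hk
      exact ⟨[a], by simp [sT]⟩
    · refine ⟨[a + k] ++ l ++ [a + k], ?_⟩
      simp only [List.map_append, List.prod_append, hl, List.map_cons, List.map_nil,
        List.prod_cons, List.prod_nil, mul_one, sT]
      push_cast
      ext x
      simp only [Equiv.Perm.mul_apply, Equiv.swap_apply_def]
      split_ifs <;> omega

theorem swap_word (a b : ℤ) : ∃ l : List ℤ, (l.map sT).prod = Equiv.swap a b := by
  rcases le_total a b with h | h
  · obtain ⟨l, hl⟩ := swap_word_aux a (b - a).toNat
    exact ⟨l, by rw [hl]; congr 1; omega⟩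
  · obtain ⟨l, hl⟩ := swap_word_aux b (a - b).toNat
    exact ⟨l, by rw [hl, Equiv.swap_comm a b]; congr 1; omega⟩

theorem word_mul {u v : Equiv.Perm ℤ} (hu : ∃ l : List ℤ, (l.map sT).prod = u)
    (hv : ∃ l : List ℤ, (l.map sT).prod = v) : ∃ l : List ℤ, (l.map sT).prod = u * v := by
  obtain ⟨l, rfl⟩ := hu
  obtain ⟨l', rfl⟩ := hv
  exact ⟨l ++ l', by simp⟩

theorem word_finite {u : Equiv.Perm ℤ} (hu : ∃ l : List ℤ, (l.map sT).prod = u) :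
    (Invs u).Finite := by
  obtain ⟨l, rfl⟩ := hu
  exact (Invs_word l).1

theorem word_swap_lt {w : Equiv.Perm ℤ} (hu : ∃ l : List ℤ, (l.map sT).prod = w) {a b : ℤ}
    (hab : a < b) (hw : w a < w b) :
    (Invs w).ncard < (Invs (w * Equiv.swap a b)).ncard :=
  Invs_swap_lt hab hw (word_finite (word_mul hu (swap_word a b)))

theorem step_del {n : ℤ} {R' : Finset (ℤ × ℤ)} {u : Equiv.Perm ℤ} {c d : ℤ} (hR : IsRC n R')
    (hw : wR n R' = u * Equiv.swap c d) (hc : 0 < c) (hd : d ≤ 0)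
    (hl : len (u * Equiv.swap c d) = len u + 1) :
    ∃ p D, p ∉ D ∧ R' = insert p D ∧ IsRC n D ∧ wR n D = u ∧ lo n D p = d ∧ hi n D p = c ∧
      u d < u c ∧ (∀ e, d < e → e < c → u d < u e → u e < u c → False) := by
  have hred : Red n R' := len_iff_red.1 hR.2
  have hu : u = wR n R' * Equiv.swap d c := by
    rw [hw, Equiv.swap_comm d c, mul_assoc, Equiv.swap_mul_self, mul_one]
  have hw1 : ∃ l : List ℤ, (l.map sT).prod = wR n R' := by
    obtain ⟨l, _, h⟩ := wR_word n R'; exact ⟨l, h⟩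
  have huw : ∃ l : List ℤ, (l.map sT).prod = u := by
    rw [hu]; exact word_mul hw1 (swap_word d c)
  have hcard : R'.card = len u + 1 := by rw [← hR.2, hw, hl]
  have hinv := Invs_red hred
  have h1 : wR n R' c < wR n R' d := by
    by_contra hcon
    have hne : wR n R' c ≠ wR n R' d := fun h => by
      have := (wR n R').injective h; omega
    have h2 := word_swap_lt hw1 (a := d) (b := c) (by omega) (by omega)
    rw [← hu] at h2
    have h3 := len_ge_of_word huw
    omega
  have hud : u d < u c := by
    rw [hw] at h1
    simpa using h1
  obtain ⟨p, hp, hlo, hhi⟩ := exists_cross R' c d (by omega) h1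
  have hins : insert p (R'.erase p) = R' := Finset.insert_erase hp
  have hpD : p ∉ R'.erase p := Finset.notMem_erase p R'
  have hlo' : lo n (R'.erase p) p = d := by
    rw [← hlo, ← lo_insert_of_not (rlt_irrefl p), hins]
  have hhi' : hi n (R'.erase p) p = c := by
    rw [← hhi, ← hi_insert_of_not (rlt_irrefl p), hins]
  have hwD : wR n (R'.erase p) = u := by
    have h3 := wR_insert n (R'.erase p) p hpD
    rw [hins, hlo', hhi'] at h3
    rw [hu, h3, mul_assoc, Equiv.swap_mul_self, mul_one]
  have hcD : (R'.erase p).card = len u := by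
    rw [Finset.card_erase_of_mem hp]; omega
  have hRD : IsRC n (R'.erase p) :=
    ⟨fun q hq => hR.1 q (Finset.mem_of_mem_erase hq), by rw [hwD, hcD]⟩
  refine ⟨p, R'.erase p, hpD, hins.symm, hRD, hwD, hlo', hhi', hud, ?_⟩
  intro e h2 h3 h4 h5
  have hiu := Invs_red (len_iff_red.1 hRD.2)
  rw [hwD, hcD] at hiu
  have e1 : Equiv.swap d e * (Equiv.swap e c * Equiv.swap d e) = Equiv.swap c d := by
    ext x
    simp only [Equiv.Perm.mul_apply, Equiv.swap_apply_def]
    split_ifs <;> omega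
  have n1 : (u * Equiv.swap d e) c = u c := by
    simp [Equiv.swap_apply_of_ne_of_ne (show c ≠ d by omega) (show c ≠ e by omega)]
  have n2 : (u * Equiv.swap d e * Equiv.swap e c) d = u e := by
    simp [Equiv.swap_apply_of_ne_of_ne (show d ≠ e by omega) (show d ≠ c by omega)]
  have n3 : (u * Equiv.swap d e * Equiv.swap e c) e = u c := by
    simp [Equiv.swap_apply_of_ne_of_ne (show c ≠ d by omega) (show c ≠ e by omega)]
  have g1 := word_swap_lt huw h2 h4
  have w1 := word_mul huw (swap_word d e)
  have g2 := word_swap_lt w1 h3 (by rw [n1]; simp; omega)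
  have w2 := word_mul w1 (swap_word e c)
  have g3 := word_swap_lt w2 h2 (by rw [n2, n3]; omega)
  rw [mul_assoc (u * Equiv.swap d e), mul_assoc u (Equiv.swap d e) (_ * _), e1, ← hw] at g3
  omega

theorem good_of {n : ℤ} {R : Finset (ℤ × ℤ)} (h : IsRC n R) (hs : StarS n R) : Good n R := by
  have hred : Red n R := len_iff_red.1 h.2
  refine ⟨fun q hq => ⟨(h.1 q hq).1, ?_, (h.1 q hq).2⟩, hred, hs⟩
  by_contra hq0
  have key : ∀ N : ℕ, ∀ q ∈ R, q.2 ≤ 0 → (aft R q).card = N → False := by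
    intro N
    induction N using Nat.strong_induction_on with
    | _ N ih =>
      intro q hq hq0 hN
      by_cases he : aft R q = ∅
      · have h1 := cross_inv hred hq
        have h2 : lo n R q = jx n q := by unfold lo; rw [he, wR_empty]; rfl
        have h3 : hi n R q = jx n q + 1 := by unfold hi; rw [he, wR_empty]; rfl
        have h4 := hs (lo n R q) (hi n R q) (by omega) (by
          rw [h3]; have := (h.1 q hq).1; unfold jx; omega)
        omega
      · obtain ⟨r, hr⟩ := Finset.nonempty_iff_ne_empty.2 he
        obtain ⟨hrR, hr1⟩ := mem_aft.1 hr
        refine ih _ ?_ r hrR ?_ rfl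
        · rw [← hN]
          apply Finset.card_lt_card
          refine Finset.ssubset_iff_subset_ne.2 ⟨?_, ?_⟩
          · intro y hy
            obtain ⟨a1, a2⟩ := mem_aft.1 hy
            exact mem_aft.2 ⟨a1, rlt_trans hr1 a2⟩
          · intro hh
            rw [← hh] at hr
            exact rlt_irrefl r (mem_aft.1 hr).2
        · unfold rlt at hr1; omega
  exact key _ q hq (by omega) rfl

/-- Partial products of the chain of transpositions. -/
def wt (w : Equiv.Perm ℤ) (c d : ℕ → ℤ) (t : ℕ) : Equiv.Perm ℤ :=
  w * ((List.range t).map fun t => Equiv.swap (c (t + 1)) (d (t + 1))).prod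

theorem wt_succ (w : Equiv.Perm ℤ) (c d : ℕ → ℤ) (t : ℕ) :
    wt w c d (t + 1) = wt w c d t * Equiv.swap (c (t + 1)) (d (t + 1)) := by
  simp [wt, List.range_succ, mul_assoc]

theorem star_step {u : Equiv.Perm ℤ} {c d : ℤ} (hc : 0 < c) (hd : d ≤ 0) (hud : u d < u c)
    (hb : ∀ e, d < e → e < c → u d < u e → u e < u c → False)
    (hs : ∀ x y, x < y → y ≤ 0 → u x < u y) :
    ∀ x y, x < y → y ≤ 0 → (u * Equiv.swap c d) x < (u * Equiv.swap c d) y := by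
  intro x y hxy hy
  have h0 := hs x y hxy hy
  simp only [Equiv.Perm.mul_apply]
  by_cases hx : x = d
  · subst hx
    rw [Equiv.swap_apply_right, Equiv.swap_apply_of_ne_of_ne (by omega) (by omega)]
    by_contra hcon
    have : u y ≠ u c := fun h => by have := u.injective h; omega
    exact hb y hxy (by omega) h0 (by omega)
  · rw [Equiv.swap_apply_of_ne_of_ne (show x ≠ c by omega) hx]
    by_cases hyd : y = d
    · subst hyd
      rw [Equiv.swap_apply_right]; omega
    · rwa [Equiv.swap_apply_of_ne_of_ne (show y ≠ c by omega) hyd]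

theorem insertWord_append (n : ℤ) (R : Finset (ℤ × ℤ)) (v : List ℕ) (x : ℕ) :
    insertWord n R (v ++ [x]) = insertOne n (insertWord n R v) x := by
  simp [insertWord]

theorem final_ind {n : ℕ} {w : Equiv.Perm ℤ} {m : ℕ} {c d : ℕ → ℤ}
    (hcd : ∀ i, 1 ≤ i → i ≤ m → 0 < c i ∧ d i ≤ 0)
    (hd : ∀ i, 1 ≤ i → i < m → d (i + 1) < d i)
    (hlen : ∀ t, t < m → len (wt w c d t * Equiv.swap (c (t + 1)) (d (t + 1))) = len (wt w c d t) + 1)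
    (hstar : ∀ t ≤ m, ∀ x y, x < y → y ≤ 0 → wt w c d t x < wt w c d t y) :
    ∀ t ≤ m, ∀ R' : Finset (ℤ × ℤ), IsRC n R' → wR n R' = wt w c d t →
    ∃ (R : Finset (ℤ × ℤ)) (a : ℕ → ℕ),
      IsRC n R ∧ wR n R = w ∧
      (∀ i, 1 ≤ i → i ≤ t → 1 ≤ a i ∧ a i ≤ n) ∧
      (∀ i, 1 ≤ i → i < t → a i ≤ a (i + 1)) ∧
      insertWord n R ((List.range t).map fun t => a (t + 1)) = R' ∧
      (1 ≤ t → ∀ (A : ℤ) (B : ℤ → ℤ), (∀ l, A ≤ l → gap n R' l (B l)) →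
        (∀ l l', A ≤ l → l ≤ l' → B l ≤ B l') → (∀ l, A ≤ l → B l < d t) → (a t : ℤ) ≤ A) := by
  intro t
  induction t with
  | zero =>
    intro _ R' hR hw
    refine ⟨R', fun _ => 0, hR, by simpa [wt] using hw, ?_, ?_, by simp [insertWord], ?_⟩
    · intro i _ _; omega
    · intro i _ _; omega
    · intro h; omega
  | succ t ih =>
    intro ht R' hR hw
    obtain ⟨hc0, hd0⟩ := hcd (t + 1) (by omega) ht
    rw [wt_succ] at hw
    obtain ⟨p, D, hp, rfl, hRD, hwD, hlo, hhi, hud, -⟩ := step_del hR hw hc0 hd0 (hlen t (by omega))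
    have hGD : Good n D := good_of hRD (by
      intro x y; rw [hwD]; exact hstar t (by omega) x y)
    have hGR : Good n (insert p D) := good_of hR (by
      intro x y; rw [hw, ← wt_succ]; exact hstar (t + 1) ht x y)
    obtain ⟨hp1, hp2, hp3⟩ := hGR.grid p (Finset.mem_insert_self _ _)
    obtain ⟨R₀, a₀, hG0, hw0, ha1, hap, hV, ⟨f, hf, hins⟩, ⟨B, hB1, hB2⟩, hlast⟩ :=
      rev _ D p rfl hGD hp hp1 hp2 hp3 (by omega) (by omega)
    have hins' : insertOne n R₀ a₀ = insert p D := by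
      apply hins (insert p D, p)
      obtain ⟨g, rfl⟩ : ∃ g, f = g + 1 := ⟨f - 1, by omega⟩
      simp [insertSteps, hR]
    obtain ⟨R, a, hRR, hwR, hab, ham, hword, hgap⟩ := ih (by omega) R₀ hG0.isRC (by rw [hw0, hwD])
    have hVp := hGD.V_open hp (by omega)
    rw [hlo, hhi] at hVp
    have hcomp : 1 ≤ t → (a t : ℤ) ≤ a₀ := by
      intro ht1
      have hdt := hd t ht1 (by omega)
      refine hgap ht1 a₀ (fun l => if l < p.2 then B l else d (t + 1)) ?_ ?_ ?_
      · intro l hl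
        by_cases hlp : l < p.2
        · simp only [hlp, if_true]; exact (hB1 l hl hlp).2
        · simp only [hlp, if_false]
          have hg : gap n D l (d (t + 1)) := by
            refine gap_persist hGD (k := p.2) hd0 hc0 (by omega) (by omega) ?_
            by_contra hcon
            have hne : V n D l (c (t + 1)) ≠ V n D l (d (t + 1)) := fun h => by
              have := (V n D l).injective h; omega
            have := inv_mono hGD.red _ (low_rows D l) (c (t + 1)) (d (t + 1)) (by omega)
              (by unfold V at hcon hne; omega)
            rw [hwD] at this
            omega
          unfold gap at hg ⊢
          rw [hV l (by omega)]; exact hg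
      · intro l l' h1 h2
        by_cases h3 : l' < p.2
        · have h4 : l < p.2 := by omega
          simp only [h3, h4, if_true]; exact hB2 l l' h1 h2 h3
        · simp only [h3, if_false]
          split_ifs with h4
          · have := (hB1 l h1 h4).1; omega
          · exact le_rfl
      · intro l h1
        try dsimp only
        split_ifs with h4
        · have := (hB1 l h1 h4).1; omega
        · exact hdt
    have hcast : ((a₀.toNat : ℕ) : ℤ) = a₀ := by omega
    have hupd : ∀ i, i ≤ t → Function.update a (t + 1) a₀.toNat i = a i := fun i hi =>
      Function.update_of_ne (by omega) _ _
    refine ⟨R, Function.update a (t + 1) a₀.toNat, hRR, hwR, ?_, ?_, ?_, ?_⟩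
    · intro i h1 h2
      by_cases h3 : i = t + 1
      · subst h3; rw [Function.update_self]; omega
      · rw [hupd i (by omega)]; exact hab i h1 (by omega)
    · intro i h1 h2
      rw [hupd i (by omega)]
      by_cases h3 : i = t
      · subst h3; rw [Function.update_self]; have := hcomp h1; omega
      · rw [hupd (i + 1) (by omega)]; exact ham i h1 (by omega)
    · have e : ((List.range t).map fun s => Function.update a (t + 1) a₀.toNat (s + 1))
          = (List.range t).map fun s => a (s + 1) := by
        apply List.map_congr_left
        intro s hs
        have := List.mem_range.1 hs
        exact hupd (s + 1) (by omega)
      rw [List.range_succ, List.map_append, e]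
      rw [List.map_cons, List.map_nil, insertWord_append, hword, Function.update_self, hcast]
      exact hins'
    · intro _ A B' h1 h2 h3
      rw [Function.update_self, hcast]
      refine hlast A B' ?_ ?_ ?_
      · intro l hl hl2
        have := h1 l hl
        unfold gap at this ⊢
        rwa [V_insert_of_lt hl2] at this
      · intro l l' x y _; exact h2 l l' x y
      · intro hA; rw [hlo]; exact h3 _ (by omega)

theorem star_all {n : ℕ} {w : Equiv.Perm ℤ} {m : ℕ} {c d : ℕ → ℤ}
    (hw : ∀ i : ℤ, i ≤ 0 → w (i - 1) < w i)
    (hcd : ∀ i, 1 ≤ i → i ≤ m → 0 < c i ∧ d i ≤ 0)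
    (hlen : ∀ t, t < m → len (wt w c d t * Equiv.swap (c (t + 1)) (d (t + 1))) = len (wt w c d t) + 1)
    (R' : Finset (ℤ × ℤ)) (hR' : IsRC n R') (hwR' : wR n R' = wt w c d m) :
    ∀ t ≤ m, ∀ x y, x < y → y ≤ 0 → wt w c d t x < wt w c d t y := by
  have hex : ∀ s ≤ m, ∃ D, IsRC n D ∧ wR n D = wt w c d (m - s) := by
    intro s
    induction s with
    | zero => intro _; exact ⟨R', hR', hwR'⟩
    | succ s ih =>
      intro hs
      obtain ⟨D, hD, hwD⟩ := ih (by omega)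
      have e : m - s = (m - (s + 1)) + 1 := by omega
      obtain ⟨hc0, hd0⟩ := hcd (m - (s + 1) + 1) (by omega) (by omega)
      rw [e, wt_succ] at hwD
      obtain ⟨p, D', -, -, h1, h2, -⟩ := step_del hD hwD hc0 hd0 (hlen _ (by omega))
      exact ⟨D', h1, h2⟩
  intro t
  induction t with
  | zero =>
    intro _ x y hxy hy
    have h1 : ∀ k : ℕ, w (y - 1 - k) < w y := by
      intro k
      induction k with
      | zero => simpa using hw y hy
      | succ k ih =>
        have := hw (y - 1 - k) (by omega)
        push_cast
        have e : y - 1 - ((k : ℤ) + 1) = y - 1 - k - 1 := by ring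
        rw [e]; omega
    have := h1 (y - 1 - x).toNat
    have e : y - 1 - (((y - 1 - x).toNat : ℕ) : ℤ) = x := by omega
    rw [e] at this
    simpa [wt] using this
  | succ t ih =>
    intro ht
    obtain ⟨hc0, hd0⟩ := hcd (t + 1) (by omega) ht
    obtain ⟨D, hD, hwD⟩ := hex (m - (t + 1)) (by omega)
    have e : m - (m - (t + 1)) = t + 1 := by omega
    rw [e, wt_succ] at hwD
    obtain ⟨p, D', -, -, -, -, -, -, h1, h2⟩ := step_del hD hwD hc0 hd0 (hlen _ (by omega))
    rw [wt_succ]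
    exact star_step hc0 hd0 h1 h2 (ih (by omega))

/-- converse to inserting a weakly increasing sequence.  If
`w(i) > w(i−1)` for all `i ≤ 0` and `c₁ > 0 ≥ d₁ > d₂ > … > d_m` form a length-additive
chain of transpositions, then every rc-graph `R′` with
`w_{R′} = w·s_{c₁,d₁}⋯s_{c_m,d_m}` arises as `R ← a₁⋯a_m` for some rc-graph `R` with
`w_R = w` and some weakly increasing sequence `1 ≤ a₁ ≤ … ≤ a_m ≤ n`. -/
theorem insert_increasing_sequence_converse (n : ℕ) (hn : 0 < n)
    (w : Equiv.Perm ℤ) (hwperm : IsPermZ n w)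
    (hw : ∀ i : ℤ, i ≤ 0 → w (i - 1) < w i)
    (m : ℕ) (c d : ℕ → ℤ)
    (hcd : ∀ i, 1 ≤ i → i ≤ m → 0 < c i ∧ d i ≤ 0)
    (hd : ∀ i, 1 ≤ i → i < m → d (i + 1) < d i)
    (hlen : ∀ m' ≤ m,
      len (w * ((List.range m').map fun t => Equiv.swap (c (t + 1)) (d (t + 1))).prod)
        = len w + m')
    (R' : Finset (ℤ × ℤ)) (hR' : IsRC n R')
    (hwR' : wR n R'
      = w * ((List.range m).map fun t => Equiv.swap (c (t + 1)) (d (t + 1))).prod) :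
    ∃ (R : Finset (ℤ × ℤ)) (a : ℕ → ℕ),
      IsRC n R ∧ wR n R = w ∧
      (∀ i, 1 ≤ i → i ≤ m → 1 ≤ a i ∧ a i ≤ n) ∧
      (∀ i, 1 ≤ i → i < m → a i ≤ a (i + 1)) ∧
      insertWord n R ((List.range m).map fun t => a (t + 1)) = R' := by
  have hl : ∀ t, t < m →
      len (wt w c d t * Equiv.swap (c (t + 1)) (d (t + 1))) = len (wt w c d t) + 1 := by
    intro t ht
    have h1 := hlen t (by omega)
    have h2 := hlen (t + 1) (by omega)
    rw [← wt_succ]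
    unfold wt
    omega
  have hs := star_all hw hcd hl R' hR' hwR'
  obtain ⟨R, a, h1, h2, h3, h4, h5, -⟩ := final_ind hcd hd hl hs m le_rfl R' hR' hwR'
  exact ⟨R, a, h1, h2, h3, h4, h5⟩

end RCGraphs
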